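/- arXiv:1101.1939 — 2 statements merged into one kernel-verified Lean document; each statement's English description precedes it below -/
import Mathlib

section
/- Let p > 2 be prime, let K be a function field over a finite field of characteristic p, and let E be a non-isotrivial elliptic curve over K (i.e., j(E) is transcendental over 𝔽_p), given by a Weierstrass equation y² = x³ + a₂x² + a₄x + a₆ with a₂, a₄, a₆ ∈ K. Let A ∈ K denote the coefficient of x^{p−1} in the polynomial (x³ + a₂x² + a₄x + a₆)^{(p−1)/2} (the Hasse invariant of E with respect to the differential dx/2y). Then E(K) contains a point of order p if and only if j(E) is a p-th power in K and A = u^{p−1} for some nonzero u ∈ K. -/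
open Polynomial WeierstrassCurve

namespace OrdP

set_option linter.unusedSectionVars false

variable {k : Type*} [Field k] {p : ℕ} [Fact p.Prime] [CharP k p]

lemma iter_deriv_pow_mul (n : ℕ) (g h : k[X]) :
    derivative^[n] (g ^ p * h) = g ^ p * derivative^[n] h := by
  have hg : derivative (g ^ p) = 0 := by
    rw [derivative_pow]; simp
  induction n with
  | zero => rfl
  | succ n ih => rw [Function.iterate_succ_apply', ih, derivative_mul, hg, zero_mul, zero_add,
      Function.iterate_succ_apply']

lemma neg_one_fact : ((p - 1).factorial : k) = -1 := by
  have h := ZMod.wilsons_lemma p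
  have h2 := congrArg (ZMod.castHom (dvd_refl p) k) h
  rwa [map_natCast, map_neg, map_one] at h2

lemma iter_deriv_of_deg (G : k[X]) (hG : G.natDegree < 2 * p - 1) :
    derivative^[p - 1] G = - C (G.coeff (p - 1)) := by
  have hp : p.Prime := Fact.out
  have hp1 := hp.one_lt
  ext n
  rw [coeff_iterate_derivative]
  rcases Nat.eq_zero_or_pos n with rfl | hn
  · rw [zero_add, Nat.descFactorial_self, nsmul_eq_mul, neg_one_fact]; simp
  · rw [coeff_neg, coeff_C_of_ne_zero hn.ne', neg_zero]
    by_cases hnp : n < p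
    · have : p ∣ (n + (p - 1)).descFactorial (p - 1) := by
        rw [Nat.descFactorial_eq_prod_range]
        have : n - 1 ∈ Finset.range (p - 1) := by simp; omega
        refine Dvd.dvd.trans ?_ (Finset.dvd_prod_of_mem _ this)
        have : n + (p - 1) - (n - 1) = p := by omega
        rw [this]
      rw [nsmul_eq_mul, (CharP.cast_eq_zero_iff k p _).2 this, zero_mul]
    · rw [coeff_eq_zero_of_natDegree_lt (by omega), smul_zero]

/-- logarithmic derivative identity -/
lemma logder [IsAlgClosed k] (a : k[X]) :
    derivative^[p - 1] (a ^ (p - 1) * derivative a) = -(derivative a) ^ p := by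
  have hp : p.Prime := Fact.out
  have hp1 := hp.one_lt
  have key : ∀ f g : k[X],
      derivative^[p - 1] (f ^ (p - 1) * derivative f) = -(derivative f) ^ p →
      derivative^[p - 1] (g ^ (p - 1) * derivative g) = -(derivative g) ^ p →
      derivative^[p - 1] ((f * g) ^ (p - 1) * derivative (f * g)) = -(derivative (f * g)) ^ p := by
    intro f g hf hg
    have e : (f * g) ^ (p - 1) * derivative (f * g) =
        g ^ p * (f ^ (p - 1) * derivative f) + f ^ p * (g ^ (p - 1) * derivative g) := by
      obtain ⟨q, hq⟩ : ∃ q, p = q + 1 := ⟨p - 1, by omega⟩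
      rw [hq, Nat.add_sub_cancel, derivative_mul]; ring
    rw [e, iterate_map_add, iter_deriv_pow_mul (p := p) _ g, iter_deriv_pow_mul (p := p) _ f, hf, hg, derivative_mul,
      add_pow_char, mul_pow, mul_pow]
    ring
  have hc : ∀ c : k, derivative^[p - 1] ((C c) ^ (p - 1) * derivative (C c)) =
      -(derivative (C c)) ^ p := by
    intro c; simp [hp.ne_zero]
  have hl : ∀ r : k, derivative^[p - 1] ((X - C r) ^ (p - 1) * derivative (X - C r)) =
      -(derivative (X - C r)) ^ p := by
    intro r
    have hm : (X - C r : k[X]).Monic := monic_X_sub_C r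
    have hd : ((X - C r : k[X]) ^ (p - 1)).natDegree = p - 1 := by
      rw [hm.natDegree_pow, natDegree_X_sub_C, mul_one]
    simp only [derivative_sub, derivative_X, derivative_C, sub_zero, mul_one, one_pow]
    rw [iter_deriv_of_deg _ (by omega)]
    have := (hm.pow (p - 1)).coeff_natDegree
    rw [hd] at this
    rw [this, C_1]
  have hs := (IsAlgClosed.splits a).eq_prod_roots
  rw [hs]
  refine key _ _ (hc _) ?_
  induction a.roots using Multiset.induction_on with
  | empty => simpa using hc 1
  | cons r s ih => rw [Multiset.map_cons, Multiset.prod_cons]; exact key _ _ (hl r) ih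

lemma logder' (a : k[X]) :
    derivative^[p - 1] (a ^ (p - 1) * derivative a) = -(derivative a) ^ p := by
  have : CharP (AlgebraicClosure k) p := charP_of_injective_algebraMap (algebraMap k _).injective p
  apply Polynomial.map_injective (algebraMap k (AlgebraicClosure k)) (algebraMap k _).injective
  have := logder (p := p) (a.map (algebraMap k (AlgebraicClosure k)))
  rw [← iterate_derivative_map, Polynomial.map_mul, Polynomial.map_pow, Polynomial.map_neg, Polynomial.map_pow, ← derivative_map]
  exact this

/-- The Hasse invariant equals `c^(p-1)`. -/
lemma A_eq {F a b : k[X]} {x α c : k} (m : ℕ) (hm : p = 2 * m + 1) (hF : F.natDegree ≤ 3)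
    (hN : a ^ 2 - F * b ^ 2 = C α * (X - C x) ^ p) (hb : b.eval x ≠ 0)
    (hab : derivative a = C c * b) (hc : c ≠ 0) :
    (F ^ m).coeff (p - 1) = c ^ (p - 1) := by
  have hp : p.Prime := Fact.out
  have hp1 := hp.one_lt
  have h1 := logder' (p := p) a
  obtain ⟨Q, hQ⟩ : ∃ Q, a ^ (p - 1) = F ^ m * b ^ (p - 1) + (X - C x) ^ p * Q := by
    have h2 : a ^ 2 - F * b ^ 2 ∣ (a ^ 2) ^ m - (F * b ^ 2) ^ m := sub_dvd_pow_sub_pow _ _ _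
    rw [hN] at h2
    obtain ⟨Q, hQ⟩ := h2
    refine ⟨C α * Q, ?_⟩
    have : p - 1 = 2 * m := by omega
    rw [this, pow_mul, pow_mul, ← mul_pow]
    linear_combination hQ
  have e : a ^ (p - 1) * derivative a =
      C c * (b ^ p * F ^ m + (X - C x) ^ p * (Q * b)) := by
    obtain ⟨q, hq⟩ : ∃ q, p = q + 1 := ⟨p - 1, by omega⟩
    rw [hab, hQ]
    conv_rhs => rw [show b ^ p = b ^ (p - 1) * b by rw [← pow_succ]; congr 1; omega]
    ring
  have hdeg : (F ^ m).natDegree < 2 * p - 1 := by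
    refine lt_of_le_of_lt (natDegree_pow_le) ?_
    have : m * F.natDegree ≤ m * 3 := Nat.mul_le_mul_left _ hF
    omega
  rw [e, iterate_derivative_C_mul, iterate_map_add, iter_deriv_pow_mul (p := p) _ b, iter_deriv_pow_mul (p := p) _ (X - C x),
    iter_deriv_of_deg _ hdeg, hab] at h1
  have h3 := congrArg (eval x) h1
  simp only [eval_mul, eval_C, eval_add, eval_pow, eval_neg, eval_sub, eval_X, sub_self,
    zero_pow hp.ne_zero, zero_mul, add_zero] at h3
  have h4 : c * b.eval x ^ p * ((F ^ m).coeff (p - 1) - c ^ (p - 1)) = 0 := by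
    have : c ^ p = c ^ (p - 1) * c := by rw [← pow_succ]; congr 1; omega
    rw [mul_pow, this] at h3
    linear_combination -h3
  rcases mul_eq_zero.1 h4 with h5 | h5
  · exact absurd h5 (mul_ne_zero hc (pow_ne_zero _ hb))
  · exact sub_eq_zero.1 h5


lemma not_dvd_pchar {F : k[X]} (hs : F.Separable) (hd : F.natDegree = 3) {α β : k} (hα : α ≠ 0)
    (x : k) (h : F ∣ C α * (X - C x) ^ p + C β) : False := by
  let K' := AlgebraicClosure k
  have : CharP K' p := charP_of_injective_algebraMap (algebraMap k K').injective p
  let i := algebraMap k K'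
  have hp : p.Prime := Fact.out
  obtain ⟨t, ht⟩ := IsAlgClosed.exists_pow_nat_eq (i (-β / α)) hp.pos
  have h1 := Polynomial.map_dvd i h
  have e : (C α * (X - C x) ^ p + C β).map i = C (i α) * (X - C (i x) - C t) ^ p := by
    rw [sub_pow_char (p := p) (X - C (i x)), ← C_pow, ht]
    simp only [Polynomial.map_add, Polynomial.map_mul, Polynomial.map_pow, Polynomial.map_sub,
      Polynomial.map_C, Polynomial.map_X]
    have : C (i β) = - (C (i α) * C (i (-β / α))) := by
      rw [← C_mul, ← C_neg, ← map_mul, ← map_neg]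
      congr 2
      field_simp
    rw [this]; ring
  rw [e] at h1
  have hu : IsUnit (C (i α)) := isUnit_C.2 (by simpa using hα)
  rw [hu.dvd_mul_left] at h1
  have hsq : Squarefree (F.map i) := (hs.map).squarefree
  rw [hsq.dvd_pow_iff_dvd hp.ne_zero] at h1
  have h2 := natDegree_le_of_dvd h1 (by
    rw [sub_sub, ← C_add]; exact X_sub_C_ne_zero _)
  rw [sub_sub, ← C_add, natDegree_X_sub_C, natDegree_map, hd] at h2
  omega

lemma degs {F a b : k[X]} {x α : k} {m : ℕ} (hm : p = 2 * m + 1) (hmo : F.Monic)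
    (hF : F.natDegree = 3) (hα : α ≠ 0)
    (hN : a ^ 2 - F * b ^ 2 = C α * (X - C x) ^ p) :
    b ≠ 0 ∧ b.natDegree + 1 = m ∧ a.natDegree ≤ m ∧ α = - b.leadingCoeff ^ 2 := by
  have hmT : ((X - C x) ^ p).Monic := (monic_X_sub_C x).pow p
  have hT : (C α * (X - C x) ^ p).natDegree = p := by
    rw [natDegree_C_mul hα, (monic_X_sub_C x).natDegree_pow, natDegree_X_sub_C, mul_one]
  have hb : b ≠ 0 := by
    rintro rfl
    have := congrArg natDegree hN
    rw [hT] at this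
    simp [natDegree_pow] at this
    omega
  have h2 : (F * b ^ 2).natDegree = 3 + 2 * b.natDegree := by
    rw [hmo.natDegree_mul' (pow_ne_zero _ hb), hF, natDegree_pow]
  have h1 : (a ^ 2).natDegree = 2 * a.natDegree := natDegree_pow _ _
  have hlt : a.natDegree < 2 + b.natDegree := by
    by_contra hcon
    have := natDegree_sub_eq_left_of_natDegree_lt (p := a ^ 2) (q := F * b ^ 2) (by omega)
    rw [hN, hT] at this
    omega
  have h3 := natDegree_sub_eq_right_of_natDegree_lt (p := a ^ 2) (q := F * b ^ 2) (by omega)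
  have h4 := leadingCoeff_sub_of_degree_lt' (p := a ^ 2) (q := F * b ^ 2)
    (degree_lt_degree (by omega))
  rw [hN, hT] at h3
  rw [hN, leadingCoeff_mul, leadingCoeff_mul, leadingCoeff_C, hmT.leadingCoeff, hmo.leadingCoeff,
    leadingCoeff_pow] at h4
  refine ⟨hb, by omega, by omega, ?_⟩
  rw [← one_mul (b.leadingCoeff ^ 2), ← h4, mul_one]

lemma deriv_T (α x : k) : derivative (C α * (X - C x) ^ p) = 0 := by
  rw [derivative_C_mul, derivative_pow]; simp

lemma two_ne (hp2 : 2 < p) : (2 : k) ≠ 0 := by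
  intro h
  have : ((2 : ℕ) : k) = 0 := by exact_mod_cast h
  rw [CharP.cast_eq_zero_iff k p] at this
  exact absurd (Nat.le_of_dvd (by norm_num) this) (by omega)

lemma const_of_deriv {a : k[X]} (ha : derivative a = 0) (hd : a.natDegree < p) :
    a = C (a.coeff 0) := by
  ext n
  rcases n with _ | n
  · simp
  · rw [coeff_C_of_ne_zero (by omega)]
    have h := congrArg (fun f => coeff f n) ha
    simp only [coeff_derivative, coeff_zero] at h
    by_cases hn : a.natDegree < n + 1
    · exact coeff_eq_zero_of_natDegree_lt hn
    · rcases mul_eq_zero.1 h with h | h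
      · exact h
      · exfalso
        have : ((n + 1 : ℕ) : k) = 0 := by exact_mod_cast h
        rw [CharP.cast_eq_zero_iff k p] at this
        exact absurd (Nat.le_of_dvd (by omega) this) (by omega)

lemma exists_c {F a b : k[X]} {x α : k} {m : ℕ} (hp2 : 2 < p) (hm : p = 2 * m + 1) (hmo : F.Monic)
    (hF : F.natDegree = 3) (hs : F.Separable) (hα : α ≠ 0)
    (hN : a ^ 2 - F * b ^ 2 = C α * (X - C x) ^ p) (hab : IsCoprime a b) :
    ∃ c : k, c ≠ 0 ∧ derivative a = C c * b ∧
      2 * C c * a = 2 * derivative b * F + b * derivative F := by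
  obtain ⟨hb, hbd, had, hl⟩ := degs hm hmo hF hα hN
  have h2 : (2 : k) ≠ 0 := two_ne hp2
  have hd := congrArg derivative hN
  rw [deriv_T] at hd
  simp only [derivative_sub, derivative_mul, derivative_pow, Nat.cast_ofNat, map_ofNat,
    Nat.add_one_sub_one, pow_one] at hd
  have hdv : b ∣ a * (2 * derivative a) :=
    ⟨2 * derivative b * F + b * derivative F, by linear_combination hd⟩
  have hu : IsUnit (2 : k[X]) := by
    have : (2 : k[X]) = C 2 := (map_ofNat C 2).symm
    rw [this]; exact isUnit_C.2 h2.isUnit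
  have hdv2 := hab.symm.dvd_of_dvd_mul_left hdv
  rw [hu.dvd_mul_left] at hdv2
  obtain ⟨q, hq⟩ := hdv2
  have hqd : q.natDegree = 0 := by
    by_cases hq0 : q = 0
    · simp [hq0]
    · have h3 := natDegree_mul hb hq0
      rw [← hq] at h3
      have := natDegree_derivative_le a
      omega
  rw [eq_C_of_natDegree_eq_zero hqd] at hq
  set c := q.coeff 0
  have h4 : 2 * C c * a = 2 * derivative b * F + b * derivative F := by
    apply mul_left_cancel₀ hb
    rw [hq] at hd
    linear_combination hd
  refine ⟨c, ?_, by rw [hq, mul_comm], h4⟩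
  intro hc
  rw [hc, C_0, mul_zero] at hq
  have ha := const_of_deriv (p := p) hq (by omega)
  refine not_dvd_pchar (p := p) hs hF (α := -α) (β := (a.coeff 0) ^ 2) (neg_ne_zero.2 hα) x
    ⟨b ^ 2, ?_⟩
  rw [ha] at hN
  rw [C_neg, C_pow]
  linear_combination hN

noncomputable def dc (δ : k →+ k) (f : k[X]) : k[X] :=
  ∑ i ∈ Finset.range (f.natDegree + 1), monomial i (δ (f.coeff i))

lemma dc_coeff (δ : k →+ k) (f : k[X]) (n : ℕ) : (dc δ f).coeff n = δ (f.coeff n) := by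
  rw [dc, finsetSum_coeff]
  simp only [coeff_monomial]
  rw [Finset.sum_ite_eq']
  split_ifs with h
  · rfl
  · rw [coeff_eq_zero_of_natDegree_lt, map_zero]
    simpa using h

lemma dc_add (δ : k →+ k) (f g : k[X]) : dc δ (f + g) = dc δ f + dc δ g := by
  ext n; simp [dc_coeff]

lemma dc_sub (δ : k →+ k) (f g : k[X]) : dc δ (f - g) = dc δ f - dc δ g := by
  ext n; simp [dc_coeff]

lemma dc_mul (δ : k →+ k) (hδ : ∀ u v, δ (u * v) = u * δ v + v * δ u) (f g : k[X]) :
    dc δ (f * g) = f * dc δ g + g * dc δ f := by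
  ext n
  rw [mul_comm g]
  simp only [dc_coeff, coeff_add, coeff_mul, map_sum, hδ, Finset.sum_add_distrib]
  congr 1
  exact Finset.sum_congr rfl fun _ _ => mul_comm _ _

lemma dc_pow (δ : k →+ k) (hδ : ∀ u v, δ (u * v) = u * δ v + v * δ u) (f : k[X]) (n : ℕ) :
    dc δ (f ^ (n + 1)) = ((n + 1 : ℕ) : k[X]) * (f ^ n * dc δ f) := by
  induction n with
  | zero => simp
  | succ n ih => rw [pow_succ, dc_mul δ hδ, ih]; push_cast; ring

lemma dc_T (δ : k →+ k) (hδ : ∀ u v, δ (u * v) = u * δ v + v * δ u) (f : k[X]) :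
    dc δ (f ^ p) = 0 := by
  have hp : p.Prime := Fact.out
  have h := dc_pow δ hδ f (p - 1)
  rw [Nat.sub_add_cancel hp.pos] at h
  rw [h]; simp

/-- infinitesimal rigidity -/
lemma kodaira {F a b : k[X]} {x : k} {m : ℕ} (hp2 : 2 < p) (hm : p = 2 * m + 1)
    (hmo : F.Monic) (hF : F.natDegree = 3) (hs : F.Separable)
    (hN : a ^ 2 - F * b ^ 2 = C (-1) * (X - C x) ^ p) (hab : IsCoprime a b)
    (δ : k →+ k) (hδ : ∀ u v, δ (u * v) = u * δ v + v * δ u) :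
    ∃ c e₀ e₁ κ : k, c ≠ 0 ∧
      C c * dc δ F = (C e₁ * X + C e₀) * derivative F - C κ * F := by
  have hα : (-1 : k) ≠ 0 := by simp
  obtain ⟨hb, hbd, had, hl⟩ := degs hm hmo hF hα hN
  obtain ⟨c, hc, hc1, hc2⟩ := exists_c hp2 hm hmo hF hs hα hN hab
  have h2 : (2 : k) ≠ 0 := two_ne hp2
  have hu : IsUnit (2 : k[X]) := by
    have : (2 : k[X]) = C 2 := (map_ofNat C 2).symm
    rw [this]; exact isUnit_C.2 h2.isUnit
  have hδ1 : δ 1 = 0 := by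
    have := hδ 1 1
    simpa using this
  have hC1 : dc δ (C (-1) : k[X]) = 0 := by
    ext n
    rw [dc_coeff, coeff_C]
    split_ifs <;> simp [hδ1]
  have hd := congrArg (dc δ) hN
  rw [dc_mul δ hδ (C (-1)), dc_T δ hδ, hC1, dc_sub, dc_mul δ hδ F, dc_pow δ hδ a 1,
    dc_pow δ hδ b 1] at hd
  simp only [pow_one, mul_zero, add_zero, Nat.reduceAdd, Nat.cast_ofNat] at hd
  have hdv : b ∣ a * (2 * dc δ a) :=
    ⟨2 * dc δ b * F + b * dc δ F, by linear_combination hd⟩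
  have hdv2 := hab.symm.dvd_of_dvd_mul_left hdv
  rw [hu.dvd_mul_left] at hdv2
  obtain ⟨e, he⟩ := hdv2
  have hed : e.natDegree ≤ 1 := by
    by_cases he0 : e = 0
    · simp [he0]
    · have h3 := natDegree_mul hb he0
      rw [← he] at h3
      have : (dc δ a).natDegree ≤ a.natDegree := by
        rw [natDegree_le_iff_coeff_eq_zero]
        intro N hN
        rw [dc_coeff, coeff_eq_zero_of_natDegree_lt hN, map_zero]
      omega
  have h5 : b * dc δ F = 2 * (a * e - F * dc δ b) := by
    apply mul_left_cancel₀ hb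
    rw [he] at hd
    linear_combination -hd
  have h6 : b * (C c * dc δ F - e * derivative F) =
      F * (2 * (e * derivative b - C c * dc δ b)) := by
    linear_combination C c * h5 + e * hc2
  have hFb : IsCoprime F b := by
    obtain ⟨u, v, huv⟩ := hab
    have huc : (2 * C c) * (C (2 * c)⁻¹) = (1 : k[X]) := by
      have : (2 : k[X]) = C 2 := (map_ofNat C 2).symm
      rw [this, ← C_mul, ← C_mul, mul_inv_cancel₀ (mul_ne_zero h2 hc), C_1]
    refine ⟨u * C (2 * c)⁻¹ * (2 * derivative b), u * C (2 * c)⁻¹ * derivative F + v, ?_⟩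
    linear_combination huv - u * C (2 * c)⁻¹ * hc2 + u * a * huc
  have h7 : F ∣ C c * dc δ F - e * derivative F :=
    hFb.dvd_of_dvd_mul_left ⟨_, h6⟩
  obtain ⟨q, hq⟩ := h7
  have hqd : q.natDegree = 0 := by
    by_cases hq0 : q = 0
    · simp [hq0]
    · have h3 := natDegree_mul hmo.ne_zero hq0
      rw [← hq] at h3
      have h8 : (dc δ F).natDegree ≤ 3 := by
        rw [natDegree_le_iff_coeff_eq_zero]
        intro N hN
        rw [dc_coeff, coeff_eq_zero_of_natDegree_lt (by omega), map_zero]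
      have h9 : (C c * dc δ F).natDegree ≤ 3 := (natDegree_C_mul_le _ _).trans h8
      have h10 : (e * derivative F).natDegree ≤ 3 := by
        refine natDegree_mul_le.trans ?_
        have := natDegree_derivative_le F
        omega
      have := (natDegree_sub_le (C c * dc δ F) (e * derivative F)).trans (max_le h9 h10)
      omega
  rw [eq_C_of_natDegree_eq_zero hqd] at hq
  refine ⟨c, e.coeff 0, e.coeff 1, - q.coeff 0, hc, ?_⟩
  have he' : e = C (e.coeff 1) * X + C (e.coeff 0) := eq_X_add_C_of_natDegree_le_one hed
  rw [← he', C_neg]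
  linear_combination hq

lemma exists_deriv (j : k) (hj : ∀ g : k, j ≠ g ^ p) :
    ∃ δ : k →+ k, (∀ u v, δ (u * v) = u * δ v + v * δ u) ∧ δ j ≠ 0 := by
  have hp : p.Prime := Fact.out
  let S : Set (Subfield k) := {M | (∀ y : k, y ^ p ∈ M) ∧ j ∉ M}
  have hS0 : (frobenius k p).fieldRange ∈ S := by
    refine ⟨fun y => ⟨y, rfl⟩, ?_⟩
    rintro ⟨g, hg⟩
    exact hj g hg.symm
  obtain ⟨M, -, hM⟩ := zorn_le_nonempty₀ S (by
    intro c hcS hc y hy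
    refine ⟨sSup c, ⟨fun z => ?_, fun hjm => ?_⟩, fun z hz => le_sSup hz⟩
    · exact (le_sSup hy : y ≤ sSup c) ((hcS hy).1 z)
    · rw [Subfield.mem_sSup_of_directedOn ⟨y, hy⟩ hc.directedOn] at hjm
      obtain ⟨s, hs, hjs⟩ := hjm
      exact (hcS hs).2 hjs) _ hS0
  have hMp := hM.prop.1
  have hMj := hM.prop.2
  have irr : ∀ y : k, y ∉ M → Irreducible (X ^ p - C (⟨y ^ p, hMp y⟩ : M)) := by
    intro y hy
    apply X_pow_sub_C_irreducible_of_prime hp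
    intro b hb
    apply hy
    have h1 : (b : k) ^ p = y ^ p := congrArg Subtype.val hb
    have h2 : (b : k) = y := frobenius_inj k p h1
    rw [← h2]; exact b.2
  have mp : ∀ y : k, y ∉ M → minpoly M y = X ^ p - C (⟨y ^ p, hMp y⟩ : M) := by
    intro y hy
    symm
    apply minpoly.eq_of_irreducible_of_monic (irr y hy)
    · simp only [map_sub, map_pow, aeval_X, aeval_C]
      exact sub_self _
    · exact monic_X_pow_sub_C _ hp.ne_zero
  have int : ∀ y : k, y ∉ M → IsIntegral M y := by
    intro y hy
    by_contra h
    have := minpoly.eq_zero h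
    rw [mp y hy] at this
    exact (monic_X_pow_sub_C _ hp.ne_zero).ne_zero this
  have fr : ∀ y : k, y ∉ M → Module.finrank M (IntermediateField.adjoin M {y}) = p := by
    intro y hy
    rw [IntermediateField.adjoin.finrank (int y hy), mp y hy, natDegree_X_pow_sub_C]
  have memj : ∀ y : k, y ∈ IntermediateField.adjoin M {j} := by
    intro y
    by_cases hy : y ∈ M
    · exact (IntermediateField.adjoin M {j}).algebraMap_mem ⟨y, hy⟩
    · have hjy : j ∈ IntermediateField.adjoin M {y} := by
        by_contra hcon
        have hmem : (IntermediateField.adjoin M {y}).toSubfield ∈ S :=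
          ⟨fun z => (IntermediateField.adjoin M {y}).algebraMap_mem ⟨z ^ p, hMp z⟩, hcon⟩
        have := hM.le_of_ge hmem
          (fun z hz => (IntermediateField.adjoin M {y}).algebraMap_mem ⟨z, hz⟩)
        exact hy (this (IntermediateField.mem_adjoin_simple_self M y))
      have hle : IntermediateField.adjoin M {j} ≤ IntermediateField.adjoin M {y} := by
        rw [IntermediateField.adjoin_simple_le_iff]; exact hjy
      have : FiniteDimensional M (IntermediateField.adjoin M {y}) :=
        IntermediateField.adjoin.finiteDimensional (int y hy)
      have h := IntermediateField.eq_of_le_of_finrank_eq hle (by rw [fr y hy, fr j hMj])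
      rw [h]
      exact IntermediateField.mem_adjoin_simple_self M y
  have sur : ∀ y : k, ∃ f : M[X], aeval j f = y := by
    intro y
    have h := memj y
    rw [← IntermediateField.mem_toSubalgebra,
      IntermediateField.adjoin_simple_toSubalgebra_of_isAlgebraic (int j hMj).isAlgebraic,
      Algebra.adjoin_singleton_eq_range_aeval] at h
    exact h
  have key : ∀ f : M[X], aeval j f = 0 → aeval j (derivative f) = 0 := by
    intro f hf
    have hd := minpoly.dvd M j hf
    obtain ⟨q, hq⟩ := hd
    have e : derivative f = minpoly M j * derivative q := by
      have : CharP M p := (algebraMap M k).charP (algebraMap M k).injective p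
      rw [hq, derivative_mul, mp j hMj]
      simp [derivative_X_pow]
    rw [e, map_mul, minpoly.aeval, zero_mul]
  choose f hf using sur
  have key2 : ∀ g : M[X], ∀ y, aeval j g = y → aeval j (derivative (f y)) = aeval j (derivative g) := by
    intro g y hg
    have := key (f y - g) (by rw [map_sub, hf, hg, sub_self])
    rw [derivative_sub, map_sub] at this
    exact sub_eq_zero.1 this
  refine ⟨AddMonoidHom.mk' (fun y => aeval j (derivative (f y))) ?_, ?_, ?_⟩
  · intro a b
    rw [key2 (f a + f b) (a + b) (by rw [map_add, hf, hf]), derivative_add, map_add]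
  · intro u v
    change aeval j (derivative (f (u * v))) = _ * aeval j (derivative (f v)) +
      _ * aeval j (derivative (f u))
    rw [key2 (f u * f v) (u * v) (by rw [map_mul, hf, hf]), derivative_mul, map_add, map_mul,
      map_mul, hf, hf]
    ring
  · change aeval j (derivative (f j)) ≠ 0
    rw [key2 X j (aeval_X j)]
    simp

section Leib
variable {R : Type*} [CommRing R]

lemma iter_leib (D : R →+ R) (hD : ∀ z w, D (z * w) = z * D w + w * D z) (n : ℕ) (z w : R) :
    D^[n] (z * w) = ∑ ij ∈ Finset.HasAntidiagonal.antidiagonal n,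
      (n.choose ij.1 : R) * (D^[ij.1] z * D^[ij.2] w) := by
  have hc : ∀ (n : ℕ) (r : R), D ((n : R) * r) = (n : R) * D r := by
    intro n r
    rw [← nsmul_eq_mul, map_nsmul, nsmul_eq_mul]
  induction n with
  | zero => simp
  | succ n ih =>
    rw [Finset.sum_antidiagonal_choose_succ_mul (fun i j => D^[i] z * D^[j] w),
      Function.iterate_succ_apply', ih, map_sum, ← Finset.sum_add_distrib]
    refine Finset.sum_congr rfl fun ij hij => ?_
    have := Finset.HasAntidiagonal.mem_antidiagonal.1 hij
    have h2 : n.choose ij.2 = n.choose ij.1 := by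
      rw [← this, Nat.choose_symm_add]
    rw [hc, hD, Function.iterate_succ_apply', Function.iterate_succ_apply', h2]
    ring

lemma leib_p (D : R →+ R) (hD : ∀ z w, D (z * w) = z * D w + w * D z) {p : ℕ} (hp : p.Prime)
    (h0 : (p : R) = 0) (z w : R) :
    D^[p] (z * w) = z * D^[p] w + w * D^[p] z := by
  rw [iter_leib D hD, Finset.Nat.sum_antidiagonal_eq_sum_range_succ_mk,
    Finset.sum_range_succ, Finset.sum_eq_single_of_mem 0 (by simp [hp.pos])]
  · simp
    ring
  · intro i hi h
    have : p ∣ p.choose i := hp.dvd_choose_self h (by simpa using hi)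
    obtain ⟨q, hq⟩ := this
    rw [hq]; push_cast; rw [h0]; ring
end Leib

/-- square-root-one-half times the Picard–Fuchs type operator -/
noncomputable def Mop (F h : k[X]) : k[X] :=
  F * derivative (derivative h) + 3 * C (2⁻¹ : k) * derivative F * derivative h
    + C (2⁻¹ : k) * derivative (derivative F) * h

noncomputable def Dop (F : k[X]) : QuadraticAlgebra k[X] F 0 →+ QuadraticAlgebra k[X] F 0 :=
  AddMonoidHom.mk' (fun z => ⟨F * derivative z.im + C (2⁻¹ : k) * derivative F * z.im,
    derivative z.re⟩) (by
    intro z w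
    ext1
    · simp only [QuadraticAlgebra.re_add, QuadraticAlgebra.im_add, derivative_add]; ring
    · simp only [QuadraticAlgebra.re_add, QuadraticAlgebra.im_add, derivative_add])

lemma Dop_apply (F : k[X]) (z : QuadraticAlgebra k[X] F 0) :
    Dop F z = ⟨F * derivative z.im + C (2⁻¹ : k) * derivative F * z.im, derivative z.re⟩ := rfl

lemma half (h2 : (2 : k) ≠ 0) : 2 * C (2⁻¹ : k) = 1 := by
  have : (2 : k[X]) = C 2 := (map_ofNat C 2).symm
  rw [this, ← C_mul, mul_inv_cancel₀ h2, C_1]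

lemma Dop_leib (h2 : (2 : k) ≠ 0) (F : k[X]) (z w : QuadraticAlgebra k[X] F 0) :
    Dop F (z * w) = z * Dop F w + w * Dop F z := by
  have hh := half h2
  ext1
  · simp only [Dop_apply, QuadraticAlgebra.re_add, QuadraticAlgebra.re_mul,
      QuadraticAlgebra.im_mul, derivative_add, derivative_mul]
    simp
    ring
  · simp only [Dop_apply, QuadraticAlgebra.im_add, QuadraticAlgebra.re_mul,
      QuadraticAlgebra.im_mul, derivative_add, derivative_mul]
    simp
    linear_combination (-derivative F * z.im * w.im) * hh

lemma Dop_sq (h2 : (2 : k) ≠ 0) (F h : k[X]) (n : ℕ) :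
    (Dop F)^[2 * n] ⟨0, h⟩ = ⟨0, (Mop F)^[n] h⟩ := by
  have h2 := half h2
  induction n generalizing h with
  | zero => rfl
  | succ n ih =>
    have : Dop F (Dop F ⟨0, h⟩) = ⟨0, Mop F h⟩ := by
      ext1
      · simp [Dop_apply]
      · simp only [Dop_apply, Mop, derivative_add, derivative_mul, derivative_C]
        linear_combination (-derivative F * derivative h) * h2
    rw [show 2 * (n + 1) = 2 * n + 1 + 1 by ring, Function.iterate_succ_apply,
      Function.iterate_succ_apply, this, ih, Function.iterate_succ_apply]

lemma Mop_iter_deriv {F : k[X]} (hF0 : F ≠ 0) {m : ℕ} (hp2 : 2 < p) (hm : p = 2 * m + 1) :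
    derivative ((Mop F)^[m] 1) = 0 := by
  have hp : p.Prime := Fact.out
  have h2 : (2 : k) ≠ 0 := two_ne hp2
  have hh := half h2
  set B := (Mop F)^[m] 1 with hB
  have h0 : ((p : ℕ) : QuadraticAlgebra k[X] F 0) = 0 := by
    ext1
    · simp
    · simp
  have hL := leib_p (Dop F) (Dop_leib h2 F) hp h0
  have hx : (Dop F)^[p] ⟨X, 0⟩ = ⟨0, B⟩ := by
    rw [hm, Function.iterate_succ_apply]
    have : Dop F ⟨X, 0⟩ = ⟨0, 1⟩ := by simp [Dop_apply]
    rw [this, Dop_sq h2]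
  have hy : (Dop F)^[p] ⟨0, 1⟩ = ⟨F * derivative B + C (2⁻¹ : k) * derivative F * B, 0⟩ := by
    rw [hm, Function.iterate_succ_apply', Dop_sq h2, Dop_apply]; simp [← hB]
  have hpoly : ∀ g : k[X], (Dop F)^[p] ⟨g, 0⟩ = ⟨0, derivative g * B⟩ := by
    intro g
    induction g using Polynomial.induction_on with
    | C a =>
      obtain ⟨q, hq⟩ : ∃ q, p = q + 1 := ⟨p - 1, by omega⟩
      have e : Dop F ⟨C a, 0⟩ = 0 := by
        ext1 <;> simp [Dop_apply]
      rw [hq, Function.iterate_succ_apply, e, iterate_map_zero]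
      ext1 <;> simp
    | add f g hf hg =>
      have : (⟨f + g, 0⟩ : QuadraticAlgebra k[X] F 0) = ⟨f, 0⟩ + ⟨g, 0⟩ := by ext1 <;> simp
      rw [this, iterate_map_add, hf, hg]
      ext1 <;> simp [add_mul]
    | monomial n a ih =>
      have : (⟨C a * X ^ (n + 1), 0⟩ : QuadraticAlgebra k[X] F 0) = ⟨C a * X ^ n, 0⟩ * ⟨X, 0⟩ := by
        ext1
        · simp; ring
        · simp
      have e2 : (C a * X ^ (n + 1) : k[X]) = C a * X ^ n * X := by ring
      rw [this, hL, ih, hx, e2, derivative_mul (f := C a * X ^ n)]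
      ext1
      · simp
      · simp; ring
  have e1 : (⟨F, 0⟩ : QuadraticAlgebra k[X] F 0) = ⟨0, 1⟩ * ⟨0, 1⟩ := by
    ext1 <;> simp
  have e2 := hpoly F
  rw [e1, hL, hy] at e2
  have e3 := congrArg QuadraticAlgebra.im e2
  simp at e3
  have e4 : F * derivative B = 0 := by
    have h3 : 2 * (F * derivative B) = 0 := by
      linear_combination e3 - derivative F * B * hh
    have : (2 : k[X]) ≠ 0 := by
      intro h; rw [h, zero_mul] at hh; exact zero_ne_one hh
    exact (mul_eq_zero.1 h3).resolve_left this
  exact (mul_eq_zero.1 e4).resolve_left hF0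

lemma Mop_add (F h g : k[X]) : Mop F (h + g) = Mop F h + Mop F g := by
  simp only [Mop, derivative_add]; ring

lemma Mop_C_mul (F h : k[X]) (c : k) : Mop F (C c * h) = C c * Mop F h := by
  simp only [Mop, derivative_C_mul]; ring

lemma Mop_natDegree {F h : k[X]} (hF : F.natDegree ≤ 3) {n : ℕ} (hh : h.natDegree ≤ n) :
    (Mop F h).natDegree ≤ n + 1 := by
  have d1 : (derivative F).natDegree ≤ 2 := (natDegree_derivative_le F).trans (by omega)
  have d2 : (derivative (derivative F)).natDegree ≤ 1 :=
    (natDegree_derivative_le _).trans (by omega)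
  have e3 : (3 : k[X]).natDegree ≤ 0 := by
    rw [show (3 : k[X]) = C 3 from (map_ofNat C 3).symm, natDegree_C]
  rcases n with _ | _ | n
  · rw [eq_C_of_natDegree_le_zero hh]
    simp only [Mop, derivative_C, mul_zero, derivative_zero, zero_add]
    refine (natDegree_mul_le_of_le (natDegree_mul_le_of_le (natDegree_C _).le d2)
      (natDegree_C _).le).trans (by omega)
  · have h1 : (derivative h).natDegree ≤ 0 := (natDegree_derivative_le h).trans (by omega)
    have h2 : derivative (derivative h) = 0 := derivative_of_natDegree_zero (by omega)
    rw [Mop, h2, mul_zero, zero_add]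
    refine natDegree_add_le_of_degree_le ?_ ?_
    · exact (natDegree_mul_le_of_le (natDegree_mul_le_of_le (natDegree_mul_le_of_le e3
        (natDegree_C _).le) d1) h1).trans (by omega)
    · exact (natDegree_mul_le_of_le (natDegree_mul_le_of_le (natDegree_C _).le d2)
        hh).trans (by omega)
  · have h1 : (derivative h).natDegree ≤ n + 1 := (natDegree_derivative_le h).trans (by omega)
    have h2 : (derivative (derivative h)).natDegree ≤ n :=
      (natDegree_derivative_le _).trans (by omega)
    refine natDegree_add_le_of_degree_le (natDegree_add_le_of_degree_le ?_ ?_) ?_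
    · exact (natDegree_mul_le_of_le hF h2).trans (by omega)
    · exact (natDegree_mul_le_of_le (natDegree_mul_le_of_le (natDegree_mul_le_of_le e3
        (natDegree_C _).le) d1) h1).trans (by omega)
    · exact (natDegree_mul_le_of_le (natDegree_mul_le_of_le (natDegree_C _).le d2)
        hh).trans (by omega)

lemma Mop_coeff (h2k : (2 : k) ≠ 0) {F h : k[X]} (hF : F.natDegree ≤ 3) (hF3 : F.coeff 3 = 1)
    {n : ℕ} (hh : h.natDegree ≤ n) :
    (Mop F h).coeff (n + 1) = 2⁻¹ * (2 * n + 3) * (n + 2) * h.coeff n := by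
  have d1 : (derivative F).natDegree ≤ 2 := (natDegree_derivative_le F).trans (by omega)
  have d2 : (derivative (derivative F)).natDegree ≤ 1 :=
    (natDegree_derivative_le _).trans (by omega)
  have c1 : (derivative F).coeff 2 = 3 := by rw [coeff_derivative, hF3]; norm_num
  have c2 : (derivative (derivative F)).coeff 1 = 6 := by
    rw [coeff_derivative, c1]; norm_num
  have e3 : (3 : k[X]) = C 3 := (map_ofNat C 3).symm
  have t1 : (derivative (derivative F) * h).coeff (1 + n) = 6 * h.coeff n := by
    rw [coeff_mul_add_eq_of_natDegree_le d2 hh, c2]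
  rw [add_comm] at t1
  have hM : (Mop F h).coeff (n + 1) = (F * derivative (derivative h)).coeff (n + 1)
      + 3 * 2⁻¹ * (derivative F * derivative h).coeff (n + 1) + 2⁻¹ * (6 * h.coeff n) := by
    rw [Mop, coeff_add, coeff_add, mul_assoc (C _) (derivative (derivative F)), coeff_C_mul, t1, e3,
      ← C_mul, mul_assoc (C _), coeff_C_mul]
  rw [hM]
  rcases n with _ | _ | n
  · have h1 : derivative h = 0 := derivative_of_natDegree_zero (by omega)
    rw [h1]; simp; field_simp; ring
  · have h1 : (derivative h).natDegree ≤ 0 := (natDegree_derivative_le h).trans (by omega)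
    have h2 : derivative (derivative h) = 0 := derivative_of_natDegree_zero (by omega)
    rw [h2]
    have t := coeff_mul_add_eq_of_natDegree_le d1 h1
    rw [c1, coeff_derivative] at t
    simp at t ⊢
    rw [t]; field_simp; ring
  · have h1 : (derivative h).natDegree ≤ n + 1 := (natDegree_derivative_le h).trans (by omega)
    have h2 : (derivative (derivative h)).natDegree ≤ n :=
      (natDegree_derivative_le _).trans (by omega)
    have t := coeff_mul_add_eq_of_natDegree_le d1 h1
    have t' := coeff_mul_add_eq_of_natDegree_le hF h2
    rw [show n + 1 + 1 + 1 = 2 + (n + 1) by ring, t, show 2 + (n + 1) = 3 + n by ring, t', c1, hF3,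
      coeff_derivative, coeff_derivative]
    push_cast; field_simp; ring

lemma cast_ne {n : ℕ} (h0 : 0 < n) (h : n < p) : (n : k) ≠ 0 := by
  intro h'
  rw [CharP.cast_eq_zero_iff k p] at h'
  exact absurd (Nat.le_of_dvd h0 h') (by omega)

lemma Mop_iter (hp2 : 2 < p) {m : ℕ} (hm : p = 2 * m + 1)
    {F : k[X]} (hF : F.natDegree ≤ 3) (hF3 : F.coeff 3 = 1) (n : ℕ) :
    ((Mop F)^[n] 1).natDegree ≤ n ∧ (n + 1 ≤ m → ((Mop F)^[n] 1).coeff n ≠ 0) := by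
  induction n with
  | zero => simp
  | succ n ih =>
    rw [Function.iterate_succ_apply']
    refine ⟨Mop_natDegree hF ih.1, fun hn => ?_⟩
    have h2 : (2 : k) ≠ 0 := two_ne hp2
    rw [Mop_coeff h2 hF hF3 ih.1]
    have h1 := ih.2 (by omega)
    have a1 : ((2 * n + 3 : ℕ) : k) ≠ 0 := cast_ne (p := p) (by omega) (by omega)
    have a2 : ((n + 2 : ℕ) : k) ≠ 0 := cast_ne (p := p) (by omega) (by omega)
    push_cast at a1 a2
    simp only [ne_eq, mul_eq_zero, inv_eq_zero, not_or]
    exact ⟨⟨⟨h2, a1⟩, a2⟩, h1⟩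

/-- `β` with `(Mop F)^m 1 = C β` -/
lemma exists_beta (hp2 : 2 < p) {m : ℕ} (hm : p = 2 * m + 1)
    {F : k[X]} (hF : F.natDegree ≤ 3) (hF3 : F.coeff 3 = 1) :
    ∃ β : k, (Mop F)^[m] 1 = C β := by
  have hF0 : F ≠ 0 := by rintro rfl; simp at hF3
  exact ⟨_, const_of_deriv (Mop_iter_deriv hF0 hp2 hm)
    (lt_of_le_of_lt (Mop_iter hp2 hm hF hF3 m).1 (by omega))⟩

lemma exists_eig (hp2 : 2 < p) {m : ℕ} (hm : p = 2 * m + 1)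
    {F : k[X]} (hF : F.natDegree ≤ 3) (hF3 : F.coeff 3 = 1) {β l : k}
    (hβ : (Mop F)^[m] 1 = C β) (hl : l ^ m = β) :
    ∃ b : k[X], Mop F b = C l * b ∧ b.natDegree + 1 ≤ m ∧ b.coeff (m - 1) ≠ 0 := by
  have key : ∀ n : ℕ, ∃ b : k[X], Mop F b - C l * b = (Mop F)^[n] 1 - C (l ^ n) ∧
      (b.natDegree + 1 ≤ n ∨ n = 0 ∧ b = 0) ∧
      (1 ≤ n → n ≤ m → b.coeff (n - 1) ≠ 0) := by
    intro n
    induction n with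
    | zero => exact ⟨0, by simp [Mop], Or.inr ⟨rfl, rfl⟩, by omega⟩
    | succ n ih =>
      obtain ⟨b, h1, h2, h3⟩ := ih
      obtain ⟨i1, i2⟩ := Mop_iter hp2 hm hF hF3 n
      refine ⟨C l * b + (Mop F)^[n] 1, ?_, Or.inl ?_, fun _ hn => ?_⟩
      · rw [Mop_add, Mop_C_mul, Function.iterate_succ_apply', pow_succ, C_mul]
        linear_combination C l * h1
      · refine Nat.succ_le_succ (natDegree_add_le_of_degree_le ?_ i1)
        refine (natDegree_C_mul_le _ _).trans ?_
        rcases h2 with h2 | ⟨h2, rfl⟩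
        · omega
        · simp
      · rw [Nat.add_sub_cancel, coeff_add, coeff_C_mul]
        have : b.coeff n = 0 := by
          rcases h2 with h2 | ⟨h2, rfl⟩
          · exact coeff_eq_zero_of_natDegree_lt (by omega)
          · simp
        rw [this, mul_zero, zero_add]
        exact i2 hn
  obtain ⟨b, h1, h2, h3⟩ := key m
  rw [hβ, hl, sub_self, sub_eq_zero] at h1
  exact ⟨b, h1, by omega, h3 (by omega) le_rfl⟩

lemma pchar_of_deriv {N : k[X]} (ha : derivative N = 0) (hd : N.natDegree ≤ p) :
    N = C (N.coeff p) * X ^ p + C (N.coeff 0) := by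
  have hp : p.Prime := Fact.out
  ext n
  rw [coeff_add, coeff_C_mul, coeff_X_pow, coeff_C]
  rcases n with _ | n
  · simp [hp.ne_zero.symm]
  · rw [if_neg (by omega : ¬ n + 1 = 0), add_zero]
    split_ifs with h
    · rw [h, mul_one]
    · rw [mul_zero]
      have h' := congrArg (fun f => coeff f n) ha
      simp only [coeff_derivative, coeff_zero] at h'
      by_cases hn : N.natDegree < n + 1
      · exact coeff_eq_zero_of_natDegree_lt hn
      · have : ((n + 1 : ℕ) : k) ≠ 0 := cast_ne (p := p) (by omega) (by omega)
        push_cast at this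
        exact (mul_eq_zero.1 h').resolve_right this

lemma sol_of_eig (hp2 : 2 < p) {m : ℕ} (hm : p = 2 * m + 1)
    {F b : k[X]} (hF : F.natDegree ≤ 3) (hF3 : F.coeff 3 = 1) {c : k} (hc : c ≠ 0)
    (hb : Mop F b = C (c ^ 2) * b) (hbd : b.natDegree + 1 ≤ m) (hb0 : b.coeff (m - 1) ≠ 0) :
    ∃ (a : k[X]) (α s : k), α ≠ 0 ∧ derivative a = C c * b ∧
      a ^ 2 - F * b ^ 2 = C α * (X ^ p - C s) := by
  have h2 : (2 : k) ≠ 0 := two_ne hp2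
  have hh := half h2
  have hcc : C c⁻¹ * C c = 1 := by rw [← C_mul, inv_mul_cancel₀ hc, C_1]
  obtain ⟨a, ha⟩ : ∃ a, a = C c⁻¹ * (derivative b * F + C 2⁻¹ * b * derivative F) := ⟨_, rfl⟩
  have ha1 : derivative a = C c * b := by
    have : derivative a = C c⁻¹ * Mop F b := by
      rw [ha, Mop]; simp only [derivative_mul, derivative_add, derivative_C]
      linear_combination (-C c⁻¹ * derivative b * derivative F) * hh
    rw [this, hb, C_pow]; linear_combination (C c * b) * hcc
  have ha2 : 2 * C c * a = 2 * derivative b * F + b * derivative F := by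
    rw [ha]
    linear_combination (2 * (derivative b * F + C 2⁻¹ * b * derivative F)) * hcc +
      b * derivative F * hh
  have hF' : (derivative F).natDegree ≤ 2 := (natDegree_derivative_le F).trans (by omega)
  have had0 : a.natDegree ≤ m + 1 := by
    rw [ha]
    refine (natDegree_C_mul_le _ _).trans (natDegree_add_le_of_degree_le ?_ ?_)
    · by_cases h : b.natDegree = 0
      · rw [derivative_of_natDegree_zero h]; simp
      · have := natDegree_derivative_le b
        exact (natDegree_mul_le_of_le this hF).trans (by omega)
    · exact (natDegree_mul_le_of_le (natDegree_C_mul_le _ _) hF').trans (by omega)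
  have had : a.natDegree ≤ m := by
    rw [natDegree_le_iff_coeff_eq_zero]
    intro i hi
    by_cases hi2 : a.natDegree < i
    · exact coeff_eq_zero_of_natDegree_lt hi2
    · obtain ⟨n, rfl⟩ : ∃ n, i = n + 1 := ⟨i - 1, by omega⟩
      have h' := congrArg (fun f => coeff f n) ha1
      simp only [coeff_derivative, coeff_C_mul] at h'
      rw [coeff_eq_zero_of_natDegree_lt (p := b) (by omega), mul_zero] at h'
      have : ((n + 1 : ℕ) : k) ≠ 0 := cast_ne (p := p) (by omega) (by omega)
      push_cast at this
      exact (mul_eq_zero.1 h').resolve_right this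
  have ha2d : (a ^ 2).natDegree ≤ 2 * m := natDegree_pow_le_of_le 2 had
  have hbd' : b.natDegree ≤ m - 1 := by omega
  have hb2d : (b ^ 2).natDegree ≤ 2 * (m - 1) := natDegree_pow_le_of_le 2 hbd'
  have hN' : derivative (a ^ 2 - F * b ^ 2) = 0 := by
    simp only [derivative_sub, derivative_mul, derivative_pow, ha1]
    simp
    rw [show (C 2 : k[X]) = 2 from map_ofNat C 2]
    linear_combination b * ha2
  have hNd : (a ^ 2 - F * b ^ 2).natDegree ≤ p := by
    refine (natDegree_sub_le _ _).trans (max_le (by omega) ?_)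
    exact (natDegree_mul_le_of_le hF hb2d).trans (by omega)
  have e := pchar_of_deriv hN' hNd
  have hα : (a ^ 2 - F * b ^ 2).coeff p = - b.coeff (m - 1) ^ 2 := by
    rw [coeff_sub, coeff_eq_zero_of_natDegree_lt (p := a ^ 2) (by omega),
      show p = 3 + 2 * (m - 1) by omega, coeff_mul_add_eq_of_natDegree_le hF hb2d, hF3,
      coeff_pow_of_natDegree_le hbd']
    ring
  have hα0 : (a ^ 2 - F * b ^ 2).coeff p ≠ 0 := by
    rw [hα]; exact neg_ne_zero.2 (pow_ne_zero _ hb0)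
  refine ⟨a, _, - (a ^ 2 - F * b ^ 2).coeff 0 / (a ^ 2 - F * b ^ 2).coeff p, hα0, ha1, ?_⟩
  have : C ((a ^ 2 - F * b ^ 2).coeff p) *
    C (- (a ^ 2 - F * b ^ 2).coeff 0 / (a ^ 2 - F * b ^ 2).coeff p) =
      - C ((a ^ 2 - F * b ^ 2).coeff 0) := by
    rw [← C_mul, mul_div_cancel₀ _ hα0, C_neg]
  rw [mul_sub, this, sub_neg_eq_add]; exact e

lemma eval_ne {F a b : k[X]} {x α c : k} {m : ℕ} (hp2 : 2 < p) (hm : p = 2 * m + 1) (hmo : F.Monic)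
    (hF : F.natDegree = 3) (hs : F.Separable) (hα : α ≠ 0) (hc : c ≠ 0)
    (ha : derivative a = C c * b)
    (hN : a ^ 2 - F * b ^ 2 = C α * (X - C x) ^ p) : b.eval x ≠ 0 := by
  obtain ⟨hb, hbd, had, hl⟩ := degs hm hmo hF hα hN
  intro hbx
  set T : k[X] := X - C x with hT
  have hTp : Prime T := prime_X_sub_C x
  obtain ⟨n, hn⟩ : ∃ n, n = rootMultiplicity x b := ⟨_, rfl⟩
  obtain ⟨b1, hb1, hb1'⟩ := exists_eq_pow_rootMultiplicity_mul_and_not_dvd b hb x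
  rw [← hn] at hb1
  have hn1 : 1 ≤ n := by
    rw [hn]; exact (rootMultiplicity_pos hb).2 hbx
  have hnb : n ≤ b.natDegree := by
    rw [hb1, natDegree_mul (pow_ne_zero _ hTp.ne_zero) (by rintro rfl; simp at hb1'),
      natDegree_pow, natDegree_X_sub_C]; omega
  have hTa : T ∣ a := by
    have h1 : T ∣ a ^ 2 := by
      have : a ^ 2 = F * b ^ 2 + C α * T ^ p := by rw [← hN]; ring
      rw [this]
      refine dvd_add ?_ ?_
      · exact Dvd.dvd.mul_left (dvd_pow (dvd_iff_isRoot.2 hbx) two_ne_zero) _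
      · exact Dvd.dvd.mul_left (dvd_pow_self _ (by omega)) _
    exact hTp.dvd_of_dvd_pow h1
  have ha0 : a ≠ 0 := by
    rintro rfl
    simp at ha
    tauto
  obtain ⟨l, hl'⟩ : ∃ l, l = rootMultiplicity x a := ⟨_, rfl⟩
  obtain ⟨a1, ha1, ha1'⟩ := exists_eq_pow_rootMultiplicity_mul_and_not_dvd a ha0 x
  rw [← hl'] at ha1
  have hl1 : 1 ≤ l := by
    rw [hl']; exact (rootMultiplicity_pos ha0).2 (dvd_iff_isRoot.1 hTa)
  have hla : l ≤ a.natDegree := by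
    rw [ha1, natDegree_mul (pow_ne_zero _ hTp.ne_zero) (by rintro rfl; simp at ha1'),
      natDegree_pow, natDegree_X_sub_C]; omega
  have hln : n + 1 ≤ l := by
    by_contra hcon
    obtain ⟨l', rfl⟩ : ∃ l', l = l' + 1 := ⟨l - 1, by omega⟩
    have h1 : T ^ (l' + 1) ∣ derivative a := by
      rw [ha, hb1]
      exact Dvd.dvd.mul_left (Dvd.dvd.mul_right (pow_dvd_pow _ (by omega)) _) _
    rw [ha1, derivative_mul, derivative_pow] at h1
    have h2 := (dvd_add_left (Dvd.intro _ rfl)).1 h1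
    have hT1 : derivative T = 1 := by simp [hT]
    rw [← hT, hT1, Nat.add_sub_cancel, mul_one, mul_comm (C _), mul_assoc, pow_succ] at h2
    have h3 := (mul_dvd_mul_iff_left (pow_ne_zero _ hTp.ne_zero)).1 h2
    have : ((l' + 1 : ℕ) : k) ≠ 0 := cast_ne (p := p) (by omega) (by omega)
    rcases hTp.dvd_or_dvd h3 with h4 | h4
    · exact hTp.not_isUnit (isUnit_of_dvd_unit h4 (isUnit_C.2 this.isUnit))
    · exact ha1' h4
  have h1 : T ^ (2 * n + 2) ∣ F * b ^ 2 := by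
    have : F * b ^ 2 = a ^ 2 - C α * T ^ p := by rw [← hN]; ring
    rw [this]
    refine dvd_sub ?_ ?_
    · rw [ha1, mul_pow, ← pow_mul]
      exact Dvd.dvd.mul_right (pow_dvd_pow _ (by omega)) _
    · exact Dvd.dvd.mul_left (pow_dvd_pow _ (by omega)) _
  rw [hb1, mul_pow, ← pow_mul, mul_left_comm, mul_comm n 2, pow_add] at h1
  have h3 := (mul_dvd_mul_iff_left (pow_ne_zero _ hTp.ne_zero)).1 h1
  have h4 : T ^ 2 ∣ F := hTp.pow_dvd_of_dvd_mul_right 2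
    (fun h => hb1' (hTp.dvd_of_dvd_pow h)) h3
  rw [sq] at h4
  exact hTp.not_isUnit (hs.squarefree T h4)

lemma iter_p_deriv (f : k[X]) : derivative^[p] f = 0 := by
  have hp : p.Prime := Fact.out
  rw [Polynomial.iterate_derivative_eq_factorial_smul_sum]
  have : ((p.factorial : ℕ) : k[X]) = 0 := by
    rw [CharP.cast_eq_zero_iff k[X] p]; exact hp.dvd_factorial.2 le_rfl
  rw [nsmul_eq_mul, this, zero_mul]

lemma beta_ne (hp2 : 2 < p) {m : ℕ} (hm : p = 2 * m + 1)
    {F : k[X]} (hF : F.natDegree = 3) (hF3 : F.coeff 3 = 1) (hs : F.Separable) {β : k}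
    (hβ : (Mop F)^[m] 1 = C β) (hA : (F ^ m).coeff (p - 1) ≠ 0) : β ≠ 0 := by
  rintro rfl
  have h2 : (2 : k) ≠ 0 := two_ne hp2
  have hh := half h2
  obtain ⟨b, hb, hbd, hb0⟩ := exists_eig hp2 hm hF.le hF3 (l := 0) hβ (zero_pow (by omega))
  rw [C_0, zero_mul] at hb
  obtain ⟨e, he⟩ : ∃ e, e = derivative b * F + C 2⁻¹ * b * derivative F := ⟨_, rfl⟩
  have he1 : derivative e = 0 := by
    rw [← hb, he, Mop]; simp only [derivative_mul, derivative_add, derivative_C]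
    linear_combination (- derivative b * derivative F) * hh
  have hF' : (derivative F).natDegree ≤ 2 := (natDegree_derivative_le F).trans (by omega)
  have hed : e.natDegree ≤ m + 1 := by
    rw [he]
    refine (natDegree_add_le_of_degree_le ?_ ?_)
    · by_cases h : b.natDegree = 0
      · rw [derivative_of_natDegree_zero h]; simp
      · have := natDegree_derivative_le b
        exact (natDegree_mul_le_of_le this hF.le).trans (by omega)
    · exact (natDegree_mul_le_of_le (natDegree_C_mul_le _ _) hF').trans (by omega)
  have hec := const_of_deriv he1 (by omega)
  set ε := e.coeff 0 with hε
  by_cases h0 : ε = 0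
  · rw [h0, C_0] at hec
    have hbd' : b.natDegree ≤ m - 1 := by omega
    have hb2d : (b ^ 2).natDegree ≤ 2 * (m - 1) := natDegree_pow_le_of_le 2 hbd'
    have hN' : derivative (F * b ^ 2) = 0 := by
      simp only [derivative_mul, derivative_pow]
      simp
      rw [show (C 2 : k[X]) = 2 from map_ofNat C 2]
      rw [hec] at he
      linear_combination (-2 * b) * he - b ^ 2 * derivative F * hh
    have hNd : (F * b ^ 2).natDegree ≤ p :=
      (natDegree_mul_le_of_le hF.le hb2d).trans (by omega)
    have e := pchar_of_deriv hN' hNd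
    have hα : (F * b ^ 2).coeff p = b.coeff (m - 1) ^ 2 := by
      rw [show p = 3 + 2 * (m - 1) by omega, coeff_mul_add_eq_of_natDegree_le hF.le hb2d, hF3,
        coeff_pow_of_natDegree_le hbd']
      ring
    refine not_dvd_pchar (p := p) hs hF (α := (F * b ^ 2).coeff p) (β := (F * b ^ 2).coeff 0)
      (by rw [hα]; exact pow_ne_zero _ hb0) 0 ?_
    rw [C_0, sub_zero, ← e]
    exact Dvd.intro _ rfl
  · have hm1 : ((m + 1 : ℕ) : k[X]) = C 2⁻¹ := by
      have : (2 : k[X]) * ((m + 1 : ℕ) : k[X]) = 1 := by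
        have h := CharP.cast_eq_zero k[X] p
        rw [hm] at h
        push_cast at h ⊢
        linear_combination h
      linear_combination C 2⁻¹ * this - ((m + 1 : ℕ) : k[X]) * hh
    have h1 : derivative (F ^ (m + 1) * b) = F ^ m * C ε := by
      rw [← hec, he, derivative_mul, derivative_pow, Nat.add_sub_cancel, C_eq_natCast, hm1]
      ring
    have h3 : derivative^[p] (F ^ (m + 1) * b) = 0 := iter_p_deriv _
    rw [show p = (p - 1) + 1 by omega, Function.iterate_succ_apply, h1, mul_comm,
      iterate_derivative_C_mul, iter_deriv_of_deg] at h3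
    · rw [mul_eq_zero, neg_eq_zero, C_eq_zero, C_eq_zero] at h3
      tauto
    · have := natDegree_pow_le_of_le m hF.le
      omega

lemma Mop_map {L : Type*} [Field L] (i : k →+* L) (F h : k[X]) :
    (Mop F h).map i = Mop (F.map i) (h.map i) := by
  have h2 : i 2 = 2 := map_ofNat i 2
  simp [Mop, h2, Polynomial.map_add, Polynomial.map_mul, derivative_map]

lemma beta_eq (hp2 : 2 < p) {m : ℕ} (hm : p = 2 * m + 1)
    {F : k[X]} (hmo : F.Monic) (hF : F.natDegree = 3) (hs : F.Separable) {β : k}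
    (hβ : (Mop F)^[m] 1 = C β) (hA : (F ^ m).coeff (p - 1) ≠ 0) : (F ^ m).coeff (p - 1) = β := by
  have hF3 : F.coeff 3 = 1 := by rw [← hF]; exact hmo
  have hβ0 := beta_ne hp2 hm hF hF3 hs hβ hA
  let L := AlgebraicClosure k
  have : CharP L p := charP_of_injective_algebraMap (algebraMap k L).injective p
  let i := algebraMap k L
  have hp : p.Prime := Fact.out
  have hmap : ∀ n, ((Mop F)^[n] 1).map i = (Mop (F.map i))^[n] 1 := by
    intro n
    induction n with
    | zero => simp
    | succ n ih => rw [Function.iterate_succ_apply', Mop_map, ih, Function.iterate_succ_apply']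
  have hβ' := hmap m
  rw [hβ, Polynomial.map_C] at hβ'
  obtain ⟨γ, hγ⟩ := IsAlgClosed.exists_pow_nat_eq (i β) (n := p - 1) (by omega)
  have hγ0 : γ ≠ 0 := by
    rintro rfl
    rw [zero_pow (by omega)] at hγ
    exact hβ0 ((map_eq_zero i).1 hγ.symm)
  have hFi : (F.map i).natDegree = 3 := by rw [natDegree_map, hF]
  have hFi3 : (F.map i).coeff 3 = 1 := by rw [coeff_map, hF3, map_one]
  obtain ⟨b, hb, hbd, hb0⟩ := exists_eig hp2 hm hFi.le hFi3 (l := γ ^ 2) hβ'.symm (by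
    rw [← pow_mul, ← hγ]; congr 1; omega)
  obtain ⟨a, α, s, hα, ha, hN⟩ := sol_of_eig hp2 hm hFi.le hFi3 hγ0 hb hbd hb0
  obtain ⟨x, hx⟩ := IsAlgClosed.exists_pow_nat_eq s hp.pos
  have hN' : a ^ 2 - F.map i * b ^ 2 = C α * (X - C x) ^ p := by
    rw [hN, sub_pow_char, ← C_pow, hx]
  have hbx := eval_ne hp2 hm (hmo.map i) hFi (hs.map) hα hγ0 ha hN'
  have := A_eq m hm hFi.le hN' hbx ha hγ0
  rw [hγ, ← Polynomial.map_pow, coeff_map] at this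
  exact i.injective this

lemma exists_sol (hp2 : 2 < p) {m : ℕ} (hm : p = 2 * m + 1)
    {F : k[X]} (hmo : F.Monic) (hF : F.natDegree = 3) (hs : F.Separable) {u : k} (hu : u ≠ 0)
    (hA : (F ^ m).coeff (p - 1) = u ^ (p - 1)) :
    ∃ (a b : k[X]) (α s : k), α ≠ 0 ∧ derivative a = C u * b ∧
      a ^ 2 - F * b ^ 2 = C α * (X ^ p - C s) := by
  have hF3 : F.coeff 3 = 1 := by rw [← hF]; exact hmo
  obtain ⟨β, hβ⟩ := exists_beta hp2 hm hF.le hF3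
  have h := beta_eq hp2 hm hmo hF hs hβ (by rw [hA]; exact pow_ne_zero _ hu)
  obtain ⟨b, hb, hbd, hb0⟩ := exists_eig hp2 hm hF.le hF3 (l := u ^ 2) hβ (by
    rw [← h, hA, ← pow_mul]; congr 1; omega)
  obtain ⟨a, α, s, hα, ha, hN⟩ := sol_of_eig hp2 hm hF.le hF3 hu hb hbd hb0
  exact ⟨a, b, α, s, hα, ha, hN⟩

section Abs
variable {R : Type*} [CommRing R] [IsDomain R]

lemma abs_forward {F : k[X]} {m : ℕ} (hm : p = 2 * m + 1) (ι : k[X] →+* R) (y : R) (σ : R →+* R)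
    (hσι : ∀ f, σ (ι f) = ι f) (hσy : σ y = - y) (hy : y ^ 2 = ι F)
    (hind : ∀ f g, ι f + ι g * y = 0 → f = 0 ∧ g = 0) (hsp : ∀ r, ∃ f g, r = ι f + ι g * y)
    {x0 y0 : k} (I J : Ideal R) (hI : I = Ideal.span {ι (X - C x0), y - ι (C y0)})
    (hJ : J = Ideal.span {ι (X - C x0), y + ι (C y0)}) (hIJ : I * J = Ideal.span {ι (X - C x0)})
    (hy0 : y0 ≠ 0) {f : R} (hf : I ^ p = Ideal.span {f}) :
    ∃ (a b : k[X]) (α : k), α ≠ 0 ∧ a ^ 2 - F * b ^ 2 = C α * (X - C x0) ^ p ∧ IsCoprime a b := by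
  have hp : p.Prime := Fact.out
  set T : k[X] := X - C x0 with hT
  have hTp : Prime T := prime_X_sub_C x0
  obtain ⟨a, b, rfl⟩ := hsp f
  have hσI : I.map σ = J := by
    rw [hI, hJ, Ideal.map_span, Set.image_pair, map_sub σ, hσι, hσι, hσy]
    refine le_antisymm ?_ ?_ <;> rw [Ideal.span_le, Set.pair_subset_iff]
    · refine ⟨Ideal.subset_span (by simp), ?_⟩
      have : y + ι (C y0) ∈ Ideal.span {ι T, y + ι (C y0)} := Ideal.subset_span (by simp)
      simpa [sub_eq_add_neg, add_comm] using neg_mem this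
    · refine ⟨Ideal.subset_span (by simp), ?_⟩
      have : - y - ι (C y0) ∈ Ideal.span {ι T, - y - ι (C y0)} := Ideal.subset_span (by simp)
      simpa [sub_eq_add_neg, add_comm] using neg_mem this
  have hinj : Function.Injective ι := by
    rw [injective_iff_map_eq_zero]
    intro g hg
    exact (hind g 0 (by simp [hg])).1
  have hJf : J ^ p = Ideal.span {ι a - ι b * y} := by
    rw [← hσI, ← Ideal.map_pow, hf, Ideal.map_span, Set.image_singleton]
    simp [hσι, hσy, sub_eq_add_neg]
  have hN : Ideal.span {ι (a ^ 2 - F * b ^ 2)} = Ideal.span {ι (T ^ p)} := by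
    have : ι (a ^ 2 - F * b ^ 2) = (ι a + ι b * y) * (ι a - ι b * y) := by
      simp only [map_sub, map_mul, map_pow, ← hy]; ring
    rw [this, ← Ideal.span_singleton_mul_span_singleton, ← hf, ← hJf, ← mul_pow, hIJ,
      Ideal.span_singleton_pow, map_pow]
  have cont : ∀ g h : k[X], Ideal.span {ι g} ≤ Ideal.span {ι h} → h ∣ g := by
    intro g h hgh
    obtain ⟨r, hr⟩ := Ideal.mem_span_singleton.1 (hgh (Ideal.mem_span_singleton_self _))
    obtain ⟨u, v, rfl⟩ := hsp r
    have := (hind (g - h * u) (- (h * v)) (by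
      rw [map_sub, hr, map_neg, map_mul, map_mul]; ring)).1
    exact ⟨u, sub_eq_zero.1 this⟩
  have hass : Associated (T ^ p) (a ^ 2 - F * b ^ 2) :=
    associated_of_dvd_dvd (cont _ _ hN.le) (cont _ _ hN.ge)
  obtain ⟨w, hw⟩ := hass
  obtain ⟨α, hα, hαw⟩ := Polynomial.isUnit_iff.1 w.isUnit
  have hN' : a ^ 2 - F * b ^ 2 = C α * T ^ p := by rw [← hw, ← hαw, mul_comm]
  refine ⟨a, b, α, hα.ne_zero, hN', ?_⟩
  have hTab : T ∣ a → ¬ T ∣ b := by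
    rintro ⟨a1, rfl⟩ ⟨b1, rfl⟩
    have hchar : CharP R p := 
      charP_of_injective_ringHom (f := ι) hinj p
    have h1 : (y - ι (C y0)) ^ p ∈ I ^ p :=
      Ideal.pow_mem_pow (by rw [hI]; exact Ideal.subset_span (by simp)) p
    rw [hf, Ideal.mem_span_singleton] at h1
    obtain ⟨r, hr⟩ := h1
    obtain ⟨u, v, huv⟩ := hsp ((ι a1 + ι b1 * y) * r)
    have h2 : (y - ι (C y0)) ^ p = ι T * (ι u + ι v * y) := by
      rw [hr, ← huv, map_mul, map_mul]; ring
    rw [sub_pow_char] at h2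
    have h3 : y ^ p = ι (F ^ m) * y := by rw [hm, pow_succ, pow_mul, hy, map_pow]
    have h4 := (hind (T * u + (C y0) ^ p) (T * v - F ^ m) (by
      rw [h3] at h2
      simp only [map_add, map_mul, map_sub, map_pow ι (C y0)]; linear_combination -h2)).1
    have h5 : T ∣ C (y0 ^ p) := ⟨- u, by rw [C_pow]; linear_combination h4⟩
    exact hTp.not_isUnit (isUnit_of_dvd_unit h5 (isUnit_C.2 (pow_ne_zero _ hy0).isUnit))
  have hNne : C α * T ^ p ≠ 0 :=
    mul_ne_zero (C_ne_zero.2 hα.ne_zero) (pow_ne_zero _ hTp.ne_zero)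
  refine isCoprime_of_irreducible_dvd ?_ ?_
  · rintro ⟨rfl, rfl⟩
    exact hNne (by rw [← hN']; simp)
  · intro z hz hza hzb
    have h1 : z ∣ C α * T ^ p := by
      rw [← hN']
      exact dvd_sub (dvd_pow hza two_ne_zero) (Dvd.dvd.mul_left (dvd_pow hzb two_ne_zero) _)
    have h2 : z ∣ T := by
      rcases hz.prime.dvd_or_dvd h1 with h | h
      · exact absurd (isUnit_of_dvd_unit h (isUnit_C.2 hα)) hz.not_isUnit
      · exact hz.prime.dvd_of_dvd_pow h
    have h3 : T ∣ z := (hz.associated_of_dvd hTp.irreducible h2).symm.dvd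
    exact hTab (h3.trans hza) (h3.trans hzb)

lemma abs_backward {F : k[X]} (h2 : (2 : k) ≠ 0) (ι : k[X] →+* R) (y : R)
    (hy : y ^ 2 = ι F)
    {x0 y0 : k} (I J : Ideal R) (hI : I = Ideal.span {ι (X - C x0), y - ι (C y0)})
    (hJ : J = Ideal.span {ι (X - C x0), y + ι (C y0)}) (hIJ : I * J = Ideal.span {ι (X - C x0)})
    {a b : k[X]} {α : k} (hα : α ≠ 0) (hN : a ^ 2 - F * b ^ 2 = C α * (X - C x0) ^ p)
    (ha : a.eval x0 ≠ 0) (hab : a.eval x0 + b.eval x0 * y0 = 0) :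
    I ^ p = Ideal.span {ι a + ι b * y} := by
  set T : k[X] := X - C x0 with hT
  obtain ⟨qa, hqa⟩ := X_sub_C_dvd_sub_C_eval (p := a) (a := x0)
  obtain ⟨qb, hqb⟩ := X_sub_C_dvd_sub_C_eval (p := b) (a := x0)
  set a0 := a.eval x0
  set b0 := b.eval x0
  have hab' : ι (C a0) + ι (C b0) * ι (C y0) = 0 := by
    rw [← map_mul, ← map_add, ← C_mul, ← C_add, hab, C_0, map_zero]
  have e1 : ι a = ι T * ι qa + ι (C a0) := by rw [← map_mul, ← hqa, map_sub]; ring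
  have e2 : ι b = ι T * ι qb + ι (C b0) := by rw [← map_mul, ← hqb, map_sub]; ring
  have hu : IsUnit (2 * ι (C a0)) := by
    have : 2 * ι (C a0) = ι (C (2 * a0)) := by rw [C_mul, map_mul, show (C 2 : k[X]) = 2 from map_ofNat C 2, map_ofNat ι 2]
    rw [this]
    exact ((mul_ne_zero h2 ha).isUnit.map C).map ι
  have c1 : IsCoprime (Ideal.span {ι a + ι b * y}) J := by
    rw [Ideal.isCoprime_iff_sup_eq]
    refine Ideal.eq_top_of_isUnit_mem _ ?_ hu
    have m1 : ι T ∈ J := by rw [hJ]; exact Ideal.subset_span (by simp)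
    have m2 : y + ι (C y0) ∈ J := by rw [hJ]; exact Ideal.subset_span (by simp)
    have m3 := Ideal.mem_span_singleton_self (ι a + ι b * y)
    have : 2 * ι (C a0) = (ι a + ι b * y) + (- (ι qa + ι qb * y) * ι T - ι (C b0) * (y + ι (C y0))) := by
      rw [e1, e2]; linear_combination hab'
    rw [this]
    exact Submodule.add_mem_sup m3 (sub_mem (J.mul_mem_left _ m1) (J.mul_mem_left _ m2))
  have c2 : IsCoprime I (Ideal.span {ι a - ι b * y}) := by
    rw [isCoprime_comm, Ideal.isCoprime_iff_sup_eq]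
    refine Ideal.eq_top_of_isUnit_mem _ ?_ hu
    have m1 : ι T ∈ I := by rw [hI]; exact Ideal.subset_span (by simp)
    have m2 : y - ι (C y0) ∈ I := by rw [hI]; exact Ideal.subset_span (by simp)
    have m3 := Ideal.mem_span_singleton_self (ι a - ι b * y)
    have : 2 * ι (C a0) = (ι a - ι b * y) + (- (ι qa - ι qb * y) * ι T + ι (C b0) * (y - ι (C y0))) := by
      rw [e1, e2]; linear_combination hab'
    rw [this]
    exact Submodule.add_mem_sup m3 (add_mem (I.mul_mem_left _ m1) (I.mul_mem_left _ m2))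
  have hprod : I ^ p * J ^ p = Ideal.span {ι a + ι b * y} * Ideal.span {ι a - ι b * y} := by
    have : (ι a + ι b * y) * (ι a - ι b * y) = ι T ^ p * ι (C α) := by
      rw [← map_pow, ← map_mul, mul_comm (T ^ p), ← hN]
      simp only [map_sub, map_mul, map_pow, ← hy]; ring
    rw [← mul_pow, hIJ, Ideal.span_singleton_mul_span_singleton, this, Ideal.span_singleton_pow,
      Ideal.span_singleton_mul_right_unit ((hα.isUnit.map C).map ι)]
  refine le_antisymm (Ideal.le_of_dvd ?_) (Ideal.le_of_dvd ?_)
  · exact (c1.pow_right (n := p)).dvd_of_dvd_mul_right (Dvd.intro _ hprod.symm)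
  · exact (c2.pow_left (m := p)).dvd_of_dvd_mul_right (Dvd.intro _ hprod)
end Abs

/-- the cubic polynomial -/
noncomputable abbrev cub (a₂ a₄ a₆ : k) : k[X] := X ^ 3 + C a₂ * X ^ 2 + C a₄ * X + C a₆

/-- the curve -/
abbrev crv (a₂ a₄ a₆ : k) : WeierstrassCurve k := ⟨0, a₂, 0, a₄, a₆⟩

section Curve
open WeierstrassCurve.Affine
variable {a₂ a₄ a₆ : k}

lemma smul_pt [DecidableEq k] (V : WeierstrassCurve k) {x y : k} (h : V.toAffine.Nonsingular x y)
    (n : ℕ) : n • (Point.some x y h : V.toAffine.Point) = 0 ↔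
      ∃ f, f ≠ 0 ∧ (CoordinateRing.XYIdeal V.toAffine x (C y)) ^ n = Ideal.span {f} := by
  rw [← Point.toClass_eq_zero, map_nsmul, Point.toClass_some]
  have := ClassGroup.mk_eq_one_of_coe_ideal (R := V.toAffine.CoordinateRing)
    (I := (CoordinateRing.XYIdeal' (W := V.toAffine) h) ^ n)
    (I' := (CoordinateRing.XYIdeal V.toAffine x (C y)) ^ n) (by
      rw [Units.val_pow_eq_pow_val, CoordinateRing.XYIdeal'_eq, FractionalIdeal.coeIdeal_pow])
  rw [map_pow] at this
  exact this

/-- embedding of polynomials -/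
noncomputable def iot (a₂ a₄ a₆ : k) : k[X] →+* (crv a₂ a₄ a₆).toAffine.CoordinateRing :=
  (CoordinateRing.mk (crv a₂ a₄ a₆).toAffine).comp C

/-- the ordinate -/
noncomputable def yy (a₂ a₄ a₆ : k) : (crv a₂ a₄ a₆).toAffine.CoordinateRing :=
  CoordinateRing.mk (crv a₂ a₄ a₆).toAffine X

lemma yy_sq : (yy a₂ a₄ a₆) ^ 2 = iot a₂ a₄ a₆ (cub a₂ a₄ a₆) := by
  have := AdjoinRoot.mk_self (f := (crv a₂ a₄ a₆).toAffine.polynomial)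
  rw [WeierstrassCurve.Affine.polynomial, map_sub, sub_eq_zero] at this
  simp only [crv, C_0, zero_mul, add_zero, map_pow] at this
  exact this

lemma iot_ind (f g : k[X]) (h : iot a₂ a₄ a₆ f + iot a₂ a₄ a₆ g * yy a₂ a₄ a₆ = 0) :
    f = 0 ∧ g = 0 := by
  apply CoordinateRing.smul_basis_eq_zero (W' := (crv a₂ a₄ a₆).toAffine)
  rw [CoordinateRing.smul, CoordinateRing.smul, mul_one]
  exact h

lemma iot_sp (r : (crv a₂ a₄ a₆).toAffine.CoordinateRing) :
    ∃ f g, r = iot a₂ a₄ a₆ f + iot a₂ a₄ a₆ g * yy a₂ a₄ a₆ := by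
  obtain ⟨f, g, h⟩ := CoordinateRing.exists_smul_basis_eq r
  rw [CoordinateRing.smul, CoordinateRing.smul, mul_one] at h
  exact ⟨f, g, h.symm⟩

/-- conjugation -/
noncomputable def sig (a₂ a₄ a₆ : k) : (crv a₂ a₄ a₆).toAffine.CoordinateRing →+*
    (crv a₂ a₄ a₆).toAffine.CoordinateRing :=
  AdjoinRoot.lift (iot a₂ a₄ a₆) (- yy a₂ a₄ a₆) (by
    have := yy_sq (a₂ := a₂) (a₄ := a₄) (a₆ := a₆)
    change eval₂ _ _ (X ^ 2 + C (C 0 * X + C 0) * X - C (cub a₂ a₄ a₆)) = 0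
    simp only [C_0, zero_mul, add_zero, eval₂_sub, eval₂_pow, eval₂_X, eval₂_C, neg_sq]
    rw [this, sub_self])

lemma sig_iot (f : k[X]) : sig a₂ a₄ a₆ (iot a₂ a₄ a₆ f) = iot a₂ a₄ a₆ f :=
  AdjoinRoot.lift_of _

lemma sig_yy : sig a₂ a₄ a₆ (yy a₂ a₄ a₆) = - yy a₂ a₄ a₆ :=
  AdjoinRoot.lift_root _

lemma XY_eq (x y : k) : CoordinateRing.XYIdeal (crv a₂ a₄ a₆).toAffine x (C y) =
    Ideal.span {iot a₂ a₄ a₆ (X - C x), yy a₂ a₄ a₆ - iot a₂ a₄ a₆ (C y)} := by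
  rw [CoordinateRing.XYIdeal, CoordinateRing.XClass, CoordinateRing.YClass,
    map_sub (CoordinateRing.mk _) X]
  rfl

lemma XY_neg_eq (x y : k) :
    CoordinateRing.XYIdeal (crv a₂ a₄ a₆).toAffine x (C ((crv a₂ a₄ a₆).toAffine.negY x y)) =
    Ideal.span {iot a₂ a₄ a₆ (X - C x), yy a₂ a₄ a₆ + iot a₂ a₄ a₆ (C y)} := by
  rw [XY_eq, WeierstrassCurve.Affine.negY]
  simp [crv]

lemma curve_forward [DecidableEq k] {m : ℕ} (hp2 : 2 < p) (hm : p = 2 * m + 1)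
    (h : ∃ P : (crv a₂ a₄ a₆).toAffine.Point, addOrderOf P = p) :
    ∃ (a b : k[X]) (x0 α : k), α ≠ 0 ∧ a ^ 2 - cub a₂ a₄ a₆ * b ^ 2 = C α * (X - C x0) ^ p ∧
      IsCoprime a b := by
  obtain ⟨P, hP⟩ := h
  have hpP : p • P = 0 := by rw [← hP]; exact addOrderOf_nsmul_eq_zero P
  rcases P with _ | ⟨x, y, h⟩
  · exfalso
    have : addOrderOf (0 : (crv a₂ a₄ a₆).toAffine.Point) = p := hP
    rw [addOrderOf_zero] at this
    omega
  · rw [smul_pt] at hpP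
    obtain ⟨f, -, hf⟩ := hpP
    have hmul := CoordinateRing.XYIdeal_neg_mul h
    rw [mul_comm] at hmul
    have hy0 : y ≠ 0 := by
      rintro rfl
      have h2 : (2 : ℕ) • (Point.some x 0 h : (crv a₂ a₄ a₆).toAffine.Point) = 0 := by
        rw [two_nsmul]
        exact Point.add_of_Y_eq rfl (by simp [WeierstrassCurve.Affine.negY])
      have := addOrderOf_dvd_of_nsmul_eq_zero h2
      rw [hP] at this
      exact absurd (Nat.le_of_dvd (by norm_num) this) (by omega)
    obtain ⟨a, b, α, h1, h2, h3⟩ := abs_forward (p := p) hm (iot a₂ a₄ a₆) (yy a₂ a₄ a₆)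
      (sig a₂ a₄ a₆) sig_iot sig_yy yy_sq iot_ind iot_sp _ _ (XY_eq x y) (XY_neg_eq x y) hmul hy0 hf
    exact ⟨a, b, x, α, h1, h2, h3⟩

lemma curve_backward [DecidableEq k] (hp2 : 2 < p) (hΔ : (crv a₂ a₄ a₆).Δ ≠ 0)
    (hs : (cub a₂ a₄ a₆).Separable) {a b : k[X]} {x0 α : k} (hα : α ≠ 0)
    (hN : a ^ 2 - cub a₂ a₄ a₆ * b ^ 2 = C α * (X - C x0) ^ p) (hb : b.eval x0 ≠ 0) :
    ∃ P : (crv a₂ a₄ a₆).toAffine.Point, addOrderOf P = p := by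
  have hp : p.Prime := Fact.out
  have hTp : Prime (X - C x0) := prime_X_sub_C x0
  obtain ⟨y0, hy0⟩ : ∃ y0, y0 = - a.eval x0 / b.eval x0 := ⟨_, rfl⟩
  have hab : a.eval x0 + b.eval x0 * y0 = 0 := by rw [hy0]; field_simp; ring
  have hyF : y0 ^ 2 = (cub a₂ a₄ a₆).eval x0 := by
    have := congrArg (eval x0) hN
    rw [eval_sub, eval_pow, eval_mul, eval_pow, eval_mul, eval_pow, eval_sub, eval_X, eval_C,
      eval_C, sub_self, zero_pow hp.ne_zero, mul_zero] at this
    rw [hy0]; field_simp; linear_combination this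
  have hns : (crv a₂ a₄ a₆).toAffine.Nonsingular x0 y0 := by
    rw [← WeierstrassCurve.Affine.equation_iff_nonsingular_of_Δ_ne_zero hΔ,
      WeierstrassCurve.Affine.equation_iff]
    simp [hyF, cub]
  have ha : a.eval x0 ≠ 0 := by
    intro ha
    have h1 : (X - C x0) ^ 2 ∣ cub a₂ a₄ a₆ * b ^ 2 := by
      have : cub a₂ a₄ a₆ * b ^ 2 = a ^ 2 - C α * (X - C x0) ^ p := by rw [← hN]; ring
      rw [this]
      exact dvd_sub (pow_dvd_pow_of_dvd (dvd_iff_isRoot.2 ha) 2)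
        (Dvd.dvd.mul_left (pow_dvd_pow _ (by omega)) _)
    have h4 := hTp.pow_dvd_of_dvd_mul_right 2
      (fun h => hb (dvd_iff_isRoot.1 (hTp.dvd_of_dvd_pow h))) h1
    rw [sq] at h4
    exact hTp.not_isUnit (hs.squarefree _ h4)
  have hmul := CoordinateRing.XYIdeal_neg_mul hns
  rw [mul_comm] at hmul
  have hI := abs_backward (p := p) (two_ne hp2) (iot a₂ a₄ a₆) (yy a₂ a₄ a₆) yy_sq _ _ (XY_eq x0 y0)
    (XY_neg_eq x0 y0) hmul hα hN ha hab
  refine ⟨Point.some x0 y0 hns, ?_⟩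
  have : Fact p.Prime := ⟨hp⟩
  refine addOrderOf_eq_prime ?_ (by intro h; cases h)
  rw [smul_pt]
  refine ⟨_, ?_, hI⟩
  intro h0
  have := (iot_ind _ _ h0).1
  rw [this] at ha
  simp at ha
end Curve

lemma cub_deriv (a₂ a₄ a₆ : k) : derivative (cub a₂ a₄ a₆) = 3 * X ^ 2 + 2 * C a₂ * X + C a₄ := by
  have e2 : (C 2 : k[X]) = 2 := map_ofNat C 2
  simp [cub, e2]
  ring

lemma cub_toPoly (a₂ a₄ a₆ : k) : cub a₂ a₄ a₆ = Cubic.toPoly ⟨1, a₂, a₄, a₆⟩ := by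
  simp [cub, Cubic.toPoly]

lemma cub_natDegree (a₂ a₄ a₆ : k) : (cub a₂ a₄ a₆).natDegree = 3 := by
  rw [cub_toPoly]; exact Cubic.natDegree_of_a_ne_zero one_ne_zero

lemma cub_monic (a₂ a₄ a₆ : k) : (cub a₂ a₄ a₆).Monic := by
  rw [cub_toPoly]; exact Cubic.leadingCoeff_of_a_ne_zero one_ne_zero

/-- discriminant -/
def dsc (a₂ a₄ a₆ : k) : k :=
  a₂ ^ 2 * a₄ ^ 2 - 4 * a₄ ^ 3 - 4 * a₂ ^ 3 * a₆ + 18 * a₂ * a₄ * a₆ - 27 * a₆ ^ 2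

lemma crv_Δ (a₂ a₄ a₆ : k) : (crv a₂ a₄ a₆).Δ = 16 * dsc a₂ a₄ a₆ := by
  simp only [WeierstrassCurve.Δ, WeierstrassCurve.b₂, WeierstrassCurve.b₄, WeierstrassCurve.b₆,
    WeierstrassCurve.b₈, dsc]
  ring

lemma crv_c₄ (a₂ a₄ a₆ : k) : (crv a₂ a₄ a₆).c₄ = 16 * (a₂ ^ 2 - 3 * a₄) := by
  simp only [WeierstrassCurve.c₄, WeierstrassCurve.b₂, WeierstrassCurve.b₄]
  ring

lemma cub_sep {a₂ a₄ a₆ : k} (h : dsc a₂ a₄ a₆ ≠ 0) : (cub a₂ a₄ a₆).Separable := by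
  have hD : C (dsc a₂ a₄ a₆)⁻¹ * C (dsc a₂ a₄ a₆) = 1 := by
    rw [← C_mul, inv_mul_cancel₀ h, C_1]
  have e : C (dsc a₂ a₄ a₆) = C a₂ ^ 2 * C a₄ ^ 2 - 4 * C a₄ ^ 3 - 4 * C a₂ ^ 3 * C a₆ +
      18 * C a₂ * C a₄ * C a₆ - 27 * C a₆ ^ 2 := by
    simp only [dsc, C_add, C_sub, C_mul, C_pow, map_ofNat]
  refine ⟨C (dsc a₂ a₄ a₆)⁻¹ * (3 * (6 * C a₄ - 2 * C a₂ ^ 2) * X - 3 * (9 * C a₆ - C a₂ * C a₄)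
      + 2 * C a₂ * (6 * C a₄ - 2 * C a₂ ^ 2)),
    - C (dsc a₂ a₄ a₆)⁻¹ * ((6 * C a₄ - 2 * C a₂ ^ 2) * X ^ 2 +
      (C a₂ * (6 * C a₄ - 2 * C a₂ ^ 2) - (9 * C a₆ - C a₂ * C a₄)) * X + 4 * C a₄ ^ 2
        - C a₂ ^ 2 * C a₄ - 3 * C a₂ * C a₆), ?_⟩
  rw [cub_deriv, ← hD, e, cub]
  ring

lemma forward_alg {a₂ a₄ a₆ : k} {m : ℕ} (hp2 : 2 < p) (hm : p = 2 * m + 1)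
    (hd : dsc a₂ a₄ a₆ ≠ 0) {a b : k[X]} {x0 α : k} (hα : α ≠ 0)
    (hN : a ^ 2 - cub a₂ a₄ a₆ * b ^ 2 = C α * (X - C x0) ^ p) (hab : IsCoprime a b) :
    (∃ g : k, (crv a₂ a₄ a₆).c₄ ^ 3 / (crv a₂ a₄ a₆).Δ = g ^ p) ∧
      ∃ u : k, u ≠ 0 ∧ ((cub a₂ a₄ a₆) ^ m).coeff (p - 1) = u ^ (p - 1) := by
  have hp : p.Prime := Fact.out
  have h2 : (2 : k) ≠ 0 := two_ne hp2
  have hmo := cub_monic a₂ a₄ a₆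
  have hF := cub_natDegree a₂ a₄ a₆
  have hs := cub_sep hd
  constructor
  · by_contra hcon
    push Not at hcon
    obtain ⟨δ, hδ, hδj⟩ := exists_deriv (p := p) _ hcon
    obtain ⟨hb, hbd, had, hl⟩ := degs hm hmo hF hα hN
    set l := b.leadingCoeff with hl'
    have hl0 : l ≠ 0 := leadingCoeff_ne_zero.2 hb
    have hu : IsUnit (C l⁻¹ : k[X]) := isUnit_C.2 (inv_ne_zero hl0).isUnit
    obtain ⟨c, e₀, e₁, κ, hc, hk⟩ := kodaira (p := p) (a := C l⁻¹ * a) (b := C l⁻¹ * b) (x := x0)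
      hp2 hm hmo hF hs (by
        have e : C (-1 : k) = C l⁻¹ ^ 2 * C α := by
          rw [← C_pow, ← C_mul, hl]; congr 1; field_simp
        rw [e, mul_assoc, ← hN]; ring) (by
        rw [isCoprime_mul_unit_left hu]; exact hab) δ hδ
    have hδ1 : δ 1 = 0 := by
      have := hδ 1 1
      simp only [one_mul] at this
      linear_combination -this
    have hdc : dc δ (cub a₂ a₄ a₆) = Cubic.toPoly ⟨0, δ a₂, δ a₄, δ a₆⟩ := by
      rw [cub_toPoly]
      ext n
      rw [dc_coeff]
      rcases n with _ | _ | _ | _ | n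
      · simp
      · simp
      · simp
      · simp [hδ1]
      · rw [Cubic.coeff_eq_zero (by omega), Cubic.coeff_eq_zero (by omega), map_zero]
    have hk2 : Cubic.toPoly ⟨0, c * δ a₂, c * δ a₄, c * δ a₆⟩ =
        Cubic.toPoly ⟨3 * e₁ - κ, 2 * a₂ * e₁ + 3 * e₀ - κ * a₂, a₄ * e₁ + 2 * a₂ * e₀ - κ * a₄,
          a₄ * e₀ - κ * a₆⟩ := by
      rw [hdc, cub_deriv] at hk
      simp only [Cubic.toPoly, C_add, C_sub, C_mul, map_ofNat, C_0] at hk ⊢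
      rw [cub] at hk
      linear_combination hk
    have hk3 := (Cubic.toPoly_injective _ _).1 hk2
    injection hk3 with k3 k2 k1 k0
    let D : Derivation ℤ k k := Derivation.mk' δ.toIntLinearMap (by
      intro u v; simp [hδ])
    have hD : ∀ z, D z = δ z := fun z => rfl
    have hnat : ∀ (n : ℕ), D (n : k) = 0 := fun n => D.map_natCast n
    have n16 : D 16 = 0 := by exact_mod_cast hnat 16
    have n3 : D 3 = 0 := by exact_mod_cast hnat 3
    have n4 : D 4 = 0 := by exact_mod_cast hnat 4
    have n18 : D 18 = 0 := by exact_mod_cast hnat 18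
    have n27 : D 27 = 0 := by exact_mod_cast hnat 27
    have hc4 : c * D (crv a₂ a₄ a₆).c₄ = -2 * e₁ * (crv a₂ a₄ a₆).c₄ := by
      rw [crv_c₄]
      simp only [map_sub, Derivation.leibniz, Derivation.leibniz_pow, smul_eq_mul, nsmul_eq_mul,
        n16, n3]
      push_cast
      simp only [hD]
      simp
      linear_combination 32 * a₂ * k2 - 48 * k1 - (32 * a₂ ^ 2 - 48 * a₄) * k3
    have hdl : c * D (crv a₂ a₄ a₆).Δ = -6 * e₁ * (crv a₂ a₄ a₆).Δ := by
      rw [crv_Δ, dsc]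
      simp only [map_sub, map_add, Derivation.leibniz, Derivation.leibniz_pow, smul_eq_mul,
        nsmul_eq_mul, n16, n4, n18, n27]
      push_cast
      simp only [hD]
      simp
      linear_combination 16 * (2 * a₂ * a₄ ^ 2 - 12 * a₂ ^ 2 * a₆ + 18 * a₄ * a₆) * k2 +
        16 * (2 * a₂ ^ 2 * a₄ - 12 * a₄ ^ 2 + 18 * a₂ * a₆) * k1 +
        16 * (-4 * a₂ ^ 3 + 18 * a₂ * a₄ - 54 * a₆) * k0 -
        16 * ((2 * a₂ * a₄ ^ 2 - 12 * a₂ ^ 2 * a₆ + 18 * a₄ * a₆) * a₂ +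
          (2 * a₂ ^ 2 * a₄ - 12 * a₄ ^ 2 + 18 * a₂ * a₆) * a₄ +
          (-4 * a₂ ^ 3 + 18 * a₂ * a₄ - 54 * a₆) * a₆) * k3
    have hΔ : (crv a₂ a₄ a₆).Δ ≠ 0 := by
      rw [crv_Δ]
      refine mul_ne_zero ?_ hd
      rw [show (16 : k) = 2 ^ 4 by norm_num]
      exact pow_ne_zero _ h2
    obtain ⟨j, hj⟩ : ∃ j, j = (crv a₂ a₄ a₆).c₄ ^ 3 / (crv a₂ a₄ a₆).Δ := ⟨_, rfl⟩
    rw [← hj] at hδj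
    rw [eq_div_iff hΔ] at hj
    have hjj := congrArg D hj
    simp only [Derivation.leibniz, Derivation.leibniz_pow, smul_eq_mul, nsmul_eq_mul] at hjj
    push_cast at hjj
    have : c * (crv a₂ a₄ a₆).Δ * D j = 0 := by
      linear_combination c * hjj - j * hdl + 3 * (crv a₂ a₄ a₆).c₄ ^ 2 * hc4 + 6 * e₁ * hj
    rw [mul_eq_zero, mul_eq_zero] at this
    rcases this with (h | h) | h
    · exact hc h
    · exact hΔ h
    · exact hδj h
  · obtain ⟨c, hc, hc1, hc2⟩ := exists_c hp2 hm hmo hF hs hα hN hab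
    refine ⟨c, hc, A_eq m hm hF.le hN ?_ hc1 hc⟩
    intro hb
    have hTp : Prime (X - C x0) := prime_X_sub_C x0
    have hTb : X - C x0 ∣ b := dvd_iff_isRoot.2 hb
    have h1 : X - C x0 ∣ a ^ 2 := by
      have : a ^ 2 = cub a₂ a₄ a₆ * b ^ 2 + C α * (X - C x0) ^ p := by rw [← hN]; ring
      rw [this]
      exact dvd_add (Dvd.dvd.mul_left (dvd_pow hTb two_ne_zero) _)
        (Dvd.dvd.mul_left (dvd_pow_self _ hp.ne_zero) _)
    exact hTp.not_isUnit (hab.isUnit_of_dvd' (hTp.dvd_of_dvd_pow h1) hTb)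

lemma dsc_frob (w2 w4 w6 : k) : dsc (w2 ^ p) (w4 ^ p) (w6 ^ p) = (dsc w2 w4 w6) ^ p := by
  have h : ∀ z : k, z ^ p = frobenius k p z := fun z => rfl
  simp only [h]
  simp only [dsc, map_add, map_sub, map_mul, map_pow, map_ofNat]

lemma cub_map (w2 w4 w6 : k) : (cub w2 w4 w6).map (frobenius k p) =
    cub (w2 ^ p) (w4 ^ p) (w6 ^ p) := by
  simp [cub, frobenius_def]

lemma coeff_shift {G : k[X]} {m : ℕ} (hm : p = 2 * m + 1) (hG : G.natDegree = 3) (r : k) :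
    ((G.comp (X + C r)) ^ m).coeff (p - 1) = (G ^ m).coeff (p - 1) := by
  have hp : p.Prime := Fact.out
  have hm0 : 0 < m := by have := hp.two_le; omega
  have h1 : (G ^ m).natDegree < 2 * p - 1 := by
    rw [natDegree_pow, hG]; omega
  have h2 : ((G.comp (X + C r)) ^ m).natDegree < 2 * p - 1 := by
    rw [natDegree_pow, natDegree_comp, hG, natDegree_X_add_C]; omega
  have e1 := iter_deriv_of_deg (p := p) _ h1
  have e2 := iter_deriv_of_deg (p := p) _ h2
  rw [← pow_comp] at e2
  have e3 : ∀ n (f : k[X]), derivative^[n] (f.comp (X + C r)) =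
      (derivative^[n] f).comp (X + C r) := by
    intro n
    induction n with
    | zero => intro f; rfl
    | succ n ih =>
      intro f
      rw [Function.iterate_succ_apply, Function.iterate_succ_apply, ← ih, derivative_comp]
      simp
  rw [e3, e1, pow_comp] at e2
  simpa using e2.symm

lemma backward_alg {a₂ a₄ a₆ r d w2 w4 w6 u : k} {m : ℕ} (hp2 : 2 < p) (hm : p = 2 * m + 1)
    (hd : dsc a₂ a₄ a₆ ≠ 0) (hd0 : d ≠ 0)
    (t2 : a₂ + 3 * r = d * w2 ^ p) (t4 : a₄ + 2 * a₂ * r + 3 * r ^ 2 = d ^ 2 * w4 ^ p)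
    (t6 : a₆ + a₄ * r + a₂ * r ^ 2 + r ^ 3 = d ^ 3 * w6 ^ p)
    (hu : u ≠ 0) (hA : ((cub a₂ a₄ a₆) ^ m).coeff (p - 1) = u ^ (p - 1)) :
    ∃ (a b : k[X]) (x0 α : k), α ≠ 0 ∧ a ^ 2 - cub a₂ a₄ a₆ * b ^ 2 = C α * (X - C x0) ^ p ∧
      b.eval x0 ≠ 0 := by
  have hp : p.Prime := Fact.out
  have hdw : dsc w2 w4 w6 ≠ 0 := by
    intro h
    apply hd
    have e1 : dsc a₂ a₄ a₆ = dsc (a₂ + 3 * r) (a₄ + 2 * a₂ * r + 3 * r ^ 2)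
      (a₆ + a₄ * r + a₂ * r ^ 2 + r ^ 3) := by simp only [dsc]; ring
    have e2 : ∀ x y z : k, dsc (d * x) (d ^ 2 * y) (d ^ 3 * z) = d ^ 6 * dsc x y z := by
      intro x y z; simp only [dsc]; ring
    rw [e1, t2, t4, t6, e2, dsc_frob, h, zero_pow hp.ne_zero, mul_zero]
  have e2 : ∀ (d x y z : k), dsc (d * x) (d ^ 2 * y) (d ^ 3 * z) = d ^ 6 * dsc x y z := by
    intro d x y z; simp only [dsc]; ring
  have hd1 : dsc (d * w2) (d ^ 2 * w4) (d ^ 3 * w6) ≠ 0 := by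
    rw [e2]; exact mul_ne_zero (pow_ne_zero _ hd0) hdw
  obtain ⟨v, hv⟩ : ∃ v, v = d ^ m := ⟨_, rfl⟩
  have hv0 : v ≠ 0 := hv ▸ pow_ne_zero _ hd0
  have hvp : d ^ p = v ^ 2 * d := by rw [hv, hm]; ring
  obtain ⟨F1, hF1⟩ : ∃ F1, F1 = cub (d * w2) (d ^ 2 * w4) (d ^ 3 * w6) := ⟨_, rfl⟩
  obtain ⟨H, hH⟩ : ∃ H, H = F1.map (frobenius k p) := ⟨_, rfl⟩
  have hHc : H = cub ((d * w2) ^ p) ((d ^ 2 * w4) ^ p) ((d ^ 3 * w6) ^ p) := by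
    rw [hH, hF1, cub_map]
  have hdH : dsc ((d * w2) ^ p) ((d ^ 2 * w4) ^ p) ((d ^ 3 * w6) ^ p) ≠ 0 := by
    rw [dsc_frob]; exact pow_ne_zero _ hd1
  have hHcomp : H.comp (C (v ^ 2) * X) = C (v ^ 6) * (cub a₂ a₄ a₆).comp (X + C r) := by
    have : (cub a₂ a₄ a₆).comp (X + C r) = cub (d * w2 ^ p) (d ^ 2 * w4 ^ p) (d ^ 3 * w6 ^ p) := by
      rw [← t2, ← t4, ← t6]
      simp [cub]
      have h2 : (C 2 : k[X]) = 2 := map_ofNat C 2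
      have h3 : (C 3 : k[X]) = 3 := map_ofNat C 3
      rw [h2, h3]
      ring
    rw [this, hHc]
    have q1 : (d * w2) ^ p = v ^ 2 * (d * w2 ^ p) := by rw [mul_pow, hvp]; ring
    have q2 : (d ^ 2 * w4) ^ p = v ^ 4 * (d ^ 2 * w4 ^ p) := by
      rw [mul_pow, ← pow_mul, mul_comm 2 p, pow_mul, hvp]; ring
    have q3 : (d ^ 3 * w6) ^ p = v ^ 6 * (d ^ 3 * w6 ^ p) := by
      rw [mul_pow, ← pow_mul, mul_comm 3 p, pow_mul, hvp]; ring
    rw [q1, q2, q3]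
    simp only [cub, add_comp, mul_comp, pow_comp, X_comp, C_comp, C_mul, C_pow]
    ring
  have hAH : (H ^ m).coeff (p - 1) = (v * u) ^ (p - 1) := by
    have h1 := congrArg (fun f : k[X] => (f ^ m).coeff (p - 1)) hHcomp
    beta_reduce at h1
    rw [← pow_comp, comp_C_mul_X_coeff, mul_pow, ← C_pow, coeff_C_mul,
      coeff_shift hm (cub_natDegree _ _ _), hA] at h1
    have h3 : (v ^ 6) ^ m = v ^ (p - 1) * (v ^ 2) ^ (p - 1) := by
      rw [hm, Nat.add_sub_cancel]; ring
    rw [h3] at h1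
    have h4 : (v ^ 2) ^ (p - 1) ≠ 0 := pow_ne_zero _ (pow_ne_zero _ hv0)
    apply mul_right_cancel₀ h4
    rw [h1, mul_pow]; ring
  have hAF : ((F1 ^ m).coeff (p - 1)) ^ p = (v * u) ^ (p - 1) := by
    rw [← hAH, hH, ← Polynomial.map_pow, coeff_map]; rfl
  obtain ⟨A1, hA1⟩ : ∃ A1, A1 = (F1 ^ m).coeff (p - 1) := ⟨_, rfl⟩
  rw [← hA1] at hAF
  have hA10 : A1 ≠ 0 := by
    rintro rfl
    rw [zero_pow hp.ne_zero] at hAF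
    exact pow_ne_zero _ (mul_ne_zero hv0 hu) hAF.symm
  have hc1 : v * u / A1 ≠ 0 := div_ne_zero (mul_ne_zero hv0 hu) hA10
  have hA2 : (F1 ^ m).coeff (p - 1) = (v * u / A1) ^ (p - 1) := by
    rw [← hA1, div_pow, ← hAF, eq_div_iff (pow_ne_zero _ hA10)]
    conv_rhs => rw [show p = (p - 1) + 1 from (Nat.sub_add_cancel hp.one_le).symm, pow_succ']
  obtain ⟨a1, b1, α, s, hα, hda, hN⟩ := exists_sol (p := p) hp2 hm
    (by rw [hF1]; exact cub_monic _ _ _)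
    (by rw [hF1]; exact cub_natDegree _ _ _) (by rw [hF1]; exact cub_sep hd1) hc1 hA2
  obtain ⟨c1, hc1'⟩ : ∃ c1, c1 = v * u / A1 := ⟨_, rfl⟩
  rw [← hc1'] at hda hc1
  have hN' : (a1.map (frobenius k p)) ^ 2 - H * (b1.map (frobenius k p)) ^ 2 =
      C (α ^ p) * (X - C s) ^ p := by
    have := congrArg (Polynomial.map (frobenius k p)) hN
    simp only [Polynomial.map_sub, Polynomial.map_mul, Polynomial.map_pow, map_X, map_C,
      frobenius_def, ← hH] at this
    rw [this, sub_pow_char, C_pow, C_pow]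
  have hda' : derivative (a1.map (frobenius k p)) = C (c1 ^ p) * b1.map (frobenius k p) := by
    rw [derivative_map, hda]; simp [frobenius_def]
  have hev := eval_ne (p := p) hp2 hm (by rw [hHc]; exact cub_monic _ _ _)
    (by rw [hHc]; exact cub_natDegree _ _ _) (by rw [hHc]; exact cub_sep hdH)
    (pow_ne_zero p hα) (pow_ne_zero p hc1) hda' hN'
  set a' := a1.map (frobenius k p)
  set b' := b1.map (frobenius k p)
  have hHF : H.comp (C (v ^ 2) * (X - C r)) = C (v ^ 6) * cub a₂ a₄ a₆ := by
    have := congrArg (fun f : k[X] => f.comp (X - C r)) hHcomp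
    simp only [comp_assoc, mul_comp, C_comp, X_comp, add_comp, sub_add_cancel, comp_X] at this
    exact this
  refine ⟨a'.comp (C (v ^ 2) * (X - C r)), C (v ^ 3) * b'.comp (C (v ^ 2) * (X - C r)),
    r + s / v ^ 2, α ^ p * (v ^ 2) ^ p, mul_ne_zero (pow_ne_zero _ hα)
      (pow_ne_zero _ (pow_ne_zero _ hv0)), ?_, ?_⟩
  · have := congrArg (fun f : k[X] => f.comp (C (v ^ 2) * (X - C r))) hN'
    simp only [sub_comp, mul_comp, pow_comp, C_comp, X_comp, hHF] at this
    have e : C (v ^ 2) * (X - C r) - C s = C (v ^ 2) * (X - C (r + s / v ^ 2)) := by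
      have : s = v ^ 2 * (s / v ^ 2) := by field_simp
      conv_lhs => rw [this]
      simp only [C_add, C_mul]; ring
    rw [e, mul_pow, ← C_pow, ← mul_assoc, ← C_mul] at this
    rw [← this]
    simp only [C_pow]
    ring
  · simp only [eval_mul, eval_C, eval_comp, eval_sub, eval_X]
    have : v ^ 2 * (r + s / v ^ 2 - r) = s := by field_simp; ring
    rw [this]
    exact mul_ne_zero (pow_ne_zero _ hv0) hev

lemma normalize {a₂ a₄ a₆ g : k} (hp2 : 2 < p) (hd : dsc a₂ a₄ a₆ ≠ 0)
    (hg : (crv a₂ a₄ a₆).c₄ ^ 3 / (crv a₂ a₄ a₆).Δ = g ^ p)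
    (hj0 : (crv a₂ a₄ a₆).c₄ ^ 3 / (crv a₂ a₄ a₆).Δ ≠ 0)
    (hj1 : (crv a₂ a₄ a₆).c₄ ^ 3 / (crv a₂ a₄ a₆).Δ - 1728 ≠ 0) :
    ∃ d r w2 w4 w6 : k, d ≠ 0 ∧ a₂ + 3 * r = d * w2 ^ p ∧
      a₄ + 2 * a₂ * r + 3 * r ^ 2 = d ^ 2 * w4 ^ p ∧
      a₆ + a₄ * r + a₂ * r ^ 2 + r ^ 3 = d ^ 3 * w6 ^ p := by
  have hp : p.Prime := Fact.out
  have h2 : (2 : k) ≠ 0 := two_ne hp2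
  have h16 : (16 : k) ≠ 0 := by
    rw [show (16 : k) = 2 ^ 4 by norm_num]; exact pow_ne_zero _ h2
  rw [crv_c₄, crv_Δ] at hg hj0 hj1
  have e1 : ∀ r : k, dsc a₂ a₄ a₆ = dsc (a₂ + 3 * r) (a₄ + 2 * a₂ * r + 3 * r ^ 2)
      (a₆ + a₄ * r + a₂ * r ^ 2 + r ^ 3) := by intro r; simp only [dsc]; ring
  have hgp : g ^ p ≠ 0 := hg ▸ hj0
  have hg0 : g ≠ 0 := fun h => hgp (by rw [h, zero_pow hp.ne_zero])
  by_cases hp3 : p = 3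
  · subst hp3
    have h3 : (3 : k) = 0 := by exact_mod_cast CharP.cast_eq_zero k 3
    have ha2 : a₂ ≠ 0 := by
      rintro rfl
      apply hj0
      rw [h3]; simp
    obtain ⟨b, hb⟩ : ∃ b, b = a₆ + a₄ * (-a₄ / (2 * a₂)) + a₂ * (-a₄ / (2 * a₂)) ^ 2
      + (-a₄ / (2 * a₂)) ^ 3 := ⟨_, rfl⟩
    have t4 : a₄ + 2 * a₂ * (-a₄ / (2 * a₂)) + 3 * (-a₄ / (2 * a₂)) ^ 2 = 0 := by
      rw [h3]; field_simp; ring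
    have e2 := e1 (-a₄ / (2 * a₂))
    rw [t4, ← hb, h3, zero_mul, add_zero] at e2
    have e3 : dsc a₂ 0 b = -4 * a₂ ^ 3 * b := by
      simp only [dsc]; linear_combination (-9) * b ^ 2 * h3
    rw [e3] at e2
    refine ⟨a₂, -a₄ / (2 * a₂), 1, 0, -4 / g, ha2, ?_, ?_, ?_⟩
    · rw [h3]; ring
    · rw [t4]; simp
    · rw [← hb, div_pow, ← hg, e2]
      rw [h3, zero_mul, sub_zero]
      have hb0 : b ≠ 0 := by
        rintro rfl
        apply hd; rw [e2]; ring
      have h4 : (4 : k) ≠ 0 := by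
        rw [show (4 : k) = 2 ^ 2 by norm_num]; exact pow_ne_zero _ h2
      field_simp
      norm_num
  · have h3 : (3 : k) ≠ 0 := by
      have := cast_ne (k := k) (p := p) (n := 3) (by norm_num) (by omega)
      exact_mod_cast this
    obtain ⟨b, hb⟩ : ∃ b, b = a₆ + a₄ * (-a₂ / 3) + a₂ * (-a₂ / 3) ^ 2
      + (-a₂ / 3) ^ 3 := ⟨_, rfl⟩
    obtain ⟨a, ha⟩ : ∃ a, a = a₄ + 2 * a₂ * (-a₂ / 3) + 3 * (-a₂ / 3) ^ 2 := ⟨_, rfl⟩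
    have t2 : a₂ + 3 * (-a₂ / 3) = 0 := by field_simp; ring
    have e2 := e1 (-a₂ / 3)
    rw [t2, ← hb, ← ha] at e2
    have e3 : dsc 0 a b = -(4 * a ^ 3 + 27 * b ^ 2) := by
      simp only [dsc]; ring
    rw [e3] at e2
    have hc : a₂ ^ 2 - 3 * a₄ = -3 * a := by
      rw [ha]; field_simp; ring
    rw [e2, hc] at hg hj0 hj1
    rw [e2] at hd
    have hq0 : 4 * a ^ 3 + 27 * b ^ 2 ≠ 0 := neg_ne_zero.1 hd
    have ha0 : a ≠ 0 := by
      rintro rfl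
      apply hj0; simp
    have hb0 : b ≠ 0 := by
      rintro rfl
      apply hj1
      have h4 : (4 : k) ≠ 0 := by
        rw [show (4 : k) = 2 ^ 2 by norm_num]; exact pow_ne_zero _ h2
      field_simp
      ring
    have hfr : ∀ z : k, z ^ p = frobenius k p z := fun z => rfl
    have hw : (27 * g / (4 * (1728 - g))) ^ p = a ^ 3 / b ^ 2 := by
      have h5 : (27 * g / (4 * (1728 - g))) ^ p = 27 * g ^ p / (4 * (1728 - g ^ p)) := by
        simp only [hfr, map_div₀, map_mul, map_sub, map_ofNat]
      have h4 : (4 : k) ≠ 0 := by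
        rw [show (4 : k) = 2 ^ 2 by norm_num]; exact pow_ne_zero _ h2
      have h6 : 1728 - g ^ p ≠ 0 := by
        rw [← hg]; intro h; apply hj1; linear_combination -h
      rw [h5, div_eq_div_iff (mul_ne_zero h4 h6) (pow_ne_zero _ hb0)]
      rw [div_eq_iff (mul_ne_zero h16 hd)] at hg
      have : (256 : k) * (27 * g ^ p * b ^ 2 - a ^ 3 * (4 * (1728 - g ^ p))) = 0 := by
        linear_combination 16 * hg
      have h256 : (256 : k) ≠ 0 := by
        rw [show (256 : k) = 2 ^ 8 by norm_num]; exact pow_ne_zero _ h2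
      exact sub_eq_zero.1 ((mul_eq_zero.1 this).resolve_left h256)
    refine ⟨b / a, -a₂ / 3, 0, 27 * g / (4 * (1728 - g)), 27 * g / (4 * (1728 - g)),
      div_ne_zero hb0 ha0, ?_, ?_, ?_⟩
    · rw [t2, zero_pow hp.ne_zero, mul_zero]
    · rw [← ha, hw]; field_simp
    · rw [← hb, hw]; field_simp

end OrdP

open Classical in
/-- Let `p > 2` be prime, `K` a function field over a finite field of characteristic `p`, and
`E : y² = x³ + a₂x² + a₄x + a₆` a non-isotrivial elliptic curve over `K` (`j(E)` transcendental
over `𝔽_p`).  Let `A` be the coefficient of `x^(p-1)` in `(x³ + a₂x² + a₄x + a₆)^((p-1)/2)`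
(the Hasse invariant).  Then `E(K)` has a point of order `p` if and only if `j(E)` is a `p`-th
power in `K` and `A = u^(p-1)` for some nonzero `u ∈ K`. -/
theorem point_of_order_p_iff
    (Fq K : Type*) [Field Fq] [Fintype Fq] [Field K]
    (p : ℕ) (hp : p.Prime) (hp2 : 2 < p) [CharP Fq p] [CharP K p]
    [Algebra (RatFunc Fq) K] (hK : FunctionField Fq K)
    (a₂ a₄ a₆ : K)
    (W : WeierstrassCurve K) (hW : W = ⟨0, a₂, 0, a₄, a₆⟩) (hΔ : W.Δ ≠ 0)
    -- non-isotriviality: `j(E)` is transcendental over the prime field `𝔽_p`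
    (hj : ∀ g : Polynomial (ZMod p),
      Polynomial.eval₂ (ZMod.castHom dvd_rfl K) (W.c₄ ^ 3 / W.Δ) g = 0 → g = 0)
    (A : K)
    (hA : A = ((X ^ 3 + C a₂ * X ^ 2 + C a₄ * X + C a₆ : K[X]) ^ ((p - 1) / 2)).coeff (p - 1)) :
    (∃ P : W.toAffine.Point, addOrderOf P = p) ↔
      ((∃ g : K, W.c₄ ^ 3 / W.Δ = g ^ p) ∧ ∃ u : K, u ≠ 0 ∧ A = u ^ (p - 1)) := by
  haveI : Fact p.Prime := ⟨hp⟩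
  obtain ⟨m, hm⟩ : ∃ m, p = 2 * m + 1 := by
    rcases hp.eq_two_or_odd' with h | h
    · omega
    · exact h
  have hm' : (p - 1) / 2 = m := by omega
  subst hW
  rw [hm'] at hA
  have hd : OrdP.dsc a₂ a₄ a₆ ≠ 0 := by
    intro h
    apply hΔ
    have := OrdP.crv_Δ a₂ a₄ a₆
    rw [h, mul_zero] at this
    exact this
  constructor
  · intro h
    obtain ⟨a, b, x0, α, hα, hN, hab⟩ := OrdP.curve_forward hp2 hm h
    obtain ⟨h1, u, hu, h2⟩ := OrdP.forward_alg hp2 hm hd hα hN hab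
    exact ⟨h1, u, hu, hA.trans h2⟩
  · rintro ⟨⟨g, hg⟩, u, hu, hAu⟩
    have hj0 : (OrdP.crv a₂ a₄ a₆).c₄ ^ 3 / (OrdP.crv a₂ a₄ a₆).Δ ≠ 0 := by
      intro h
      have := hj X (by rw [eval₂_X]; exact h)
      exact X_ne_zero this
    have hj1 : (OrdP.crv a₂ a₄ a₆).c₄ ^ 3 / (OrdP.crv a₂ a₄ a₆).Δ - 1728 ≠ 0 := by
      intro h
      have := hj (X - C 1728) (by
        rw [eval₂_sub, eval₂_X, eval₂_C, map_ofNat]; exact h)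
      exact X_sub_C_ne_zero _ this
    obtain ⟨d, r, w2, w4, w6, hd0, t2, t4, t6⟩ := OrdP.normalize hp2 hd hg hj0 hj1
    obtain ⟨a, b, x0, α, hα, hN, hb⟩ := OrdP.backward_alg hp2 hm hd hd0 t2 t4 t6 hu
      (hA.symm.trans hAu)
    exact OrdP.curve_backward hp2 hΔ (OrdP.cub_sep hd) hα hN hb
end

section
/- Let F be a field of characteristic zero and V a finite-dimensional F-vector space with an internal direct sum decomposition V = ⊕_{i ∈ ℤ/aℤ} W_i indexed by ℤ/aℤ, where a is a positive even integer. Let φ : V → V be an invertible linear map with φ(W_i) = W_{i+1} for all i ∈ ℤ/aℤ. Suppose V carries a non-degenerate symmetric bilinear form ⟨·,·⟩ satisfying ⟨φx, φy⟩ = ⟨x, y⟩ for all x, y ∈ V, and suppose the form induces an isomorphism W_{a/2} ≅ W_0^* (i.e., the linear map W_{a/2} → W_0^* sending w to the functional ⟨w, ·⟩ restricted to W_0 is bijective). If dim W_0 is odd, then the polynomial 1 − T^a divides det(1 − φT | V); equivalently, since φ is invertible, X^a − 1 divides the characteristic polynomial of φ. -/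
/-- **Linear algebra lemma for analytic ranks.**  Let `V` be a finite-dimensional vector space
over a field `F` of characteristic zero, with an internal direct sum decomposition
`V = ⊕_{i ∈ ℤ/aℤ} W i` where `a` is a positive even integer.  Let `φ : V ≃ V` be an invertible
linear map with `φ(W i) = W (i+1)` for all `i`.  Suppose `V` carries a non-degenerate symmetric
bilinear form `B` that is `φ`-invariant and induces an isomorphism `W (a/2) ≅ (W 0)*`.
If `dim W 0` is odd, then `X^a − 1` divides the characteristic polynomial of `φ`
(equivalently, `1 − T^a` divides `det(1 − φT | V)`). -/
theorem linear_algebra_lemma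
    (F : Type*) [Field F] [CharZero F]
    (V : Type*) [AddCommGroup V] [Module F V] [FiniteDimensional F V]
    (a : ℕ) (ha0 : 0 < a) (ha : Even a)
    (W : ZMod a → Submodule F V) (hW : DirectSum.IsInternal W)
    (φ : V ≃ₗ[F] V) (hφ : ∀ i : ZMod a, Submodule.map (φ : V →ₗ[F] V) (W i) = W (i + 1))
    (B : V →ₗ[F] V →ₗ[F] F)
    (hsymm : ∀ x y : V, B x y = B y x)
    (hnd : ∀ x : V, (∀ y : V, B x y = 0) → x = 0)
    (hinv : ∀ x y : V, B (φ x) (φ y) = B x y)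
    (hdual : Function.Bijective
      (fun w : W ((a / 2 : ℕ) : ZMod a) => (B w.1).domRestrict (W (0 : ZMod a))))
    (hodd : Odd (Module.finrank F (W (0 : ZMod a)))) :
    (Polynomial.X ^ a - 1 : Polynomial F) ∣ LinearMap.charpoly (φ : V →ₗ[F] V) := by
  classical
  set f : V →ₗ[F] V := (φ : V →ₗ[F] V) with hf
  have hinvk : ∀ (k : ℕ) (x y : V), B ((f ^ k) x) ((f ^ k) y) = B x y := by
    intro k
    induction k with
    | zero => intro x y; simp
    | succ k ih =>
      intro x y
      rw [pow_succ', Module.End.mul_apply, Module.End.mul_apply]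
      exact (hinv _ _).trans (ih x y)
  have hmapk : ∀ (k : ℕ), Submodule.map (f ^ k) (W 0) = W (k : ZMod a) := by
    intro k
    induction k with
    | zero => rw [pow_zero, Nat.cast_zero]; exact Submodule.map_id (W 0)
    | succ k ih =>
      rw [pow_succ', Module.End.mul_eq_comp, Submodule.map_comp, ih, hφ]
      simp
  have hmem : ∀ (k : ℕ) (x : V), x ∈ W 0 → (f ^ k) x ∈ W (k : ZMod a) := by
    intro k x hx
    rw [← hmapk k]
    exact Submodule.mem_map_of_mem hx
  have haa : a / 2 + a / 2 = a := by
    obtain ⟨m, hm⟩ := ha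
    omega
  -- a fixed vector of the a-th power
  obtain ⟨w, hw0, hwne, hwfix⟩ : ∃ w : V, w ∈ W 0 ∧ w ≠ 0 ∧ (f ^ a) w = w := by
    let e := Module.finBasis F (W (0 : ZMod a))
    let A : Matrix (Fin (Module.finrank F (W (0 : ZMod a))))
        (Fin (Module.finrank F (W (0 : ZMod a)))) F :=
      Matrix.of fun i j => B ((f ^ (a / 2)) (e i)) (e j) - B ((f ^ (a / 2)) (e j)) (e i)
    have hA : A.transpose = -A := by
      ext i j
      simp [A, Matrix.transpose_apply]
    have hdet : A.det = 0 := by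
      have h1 := congrArg Matrix.det hA
      rw [Matrix.det_transpose, Matrix.det_neg, Fintype.card_fin, hodd.neg_one_pow] at h1
      have h2 : (2 : F) * A.det = 0 := by linear_combination h1
      simpa using h2
    obtain ⟨v, hv, hAv⟩ := Matrix.exists_mulVec_eq_zero_iff.mpr hdet
    let w : W (0 : ZMod a) := ∑ j, v j • e j
    have hwne : w ≠ 0 := by
      intro h
      apply hv
      funext j
      exact Fintype.linearIndependent_iff.mp e.linearIndependent v h j
    have hker : ∀ i, B ((f ^ (a / 2)) (e i)) w = B ((f ^ (a / 2)) w) (e i) := by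
      intro i
      have h := congrFun hAv i
      simp only [Matrix.mulVec, dotProduct, A, Matrix.of_apply, Pi.zero_apply] at h
      rw [← sub_eq_zero, ← h]
      simp only [w, Submodule.coe_sum, Submodule.coe_smul, map_sum, map_smul,
        LinearMap.sum_apply, LinearMap.smul_apply, smul_eq_mul, sub_mul, Finset.sum_sub_distrib]
      congr 1 <;> exact Finset.sum_congr rfl fun _ _ => mul_comm _ _
    have hker2 : ∀ x : W (0 : ZMod a),
        B ((f ^ (a / 2)) x) w = B ((f ^ (a / 2)) w) x := by
      have : ((B.flip (w : V)) ∘ₗ (f ^ (a / 2))) ∘ₗ (W (0 : ZMod a)).subtype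
          = (B ((f ^ (a / 2)) w)) ∘ₗ (W (0 : ZMod a)).subtype := by
        apply e.ext
        intro i
        simpa using hker i
      intro x
      simpa using LinearMap.congr_fun this x
    have hfa : (f ^ a) (w : V) ∈ W 0 := by
      have := hmem a w w.2
      simpa using this
    have hz : (⟨(f ^ a) (w : V), hfa⟩ : W (0 : ZMod a)) - w = 0 := by
      rw [← Module.forall_dual_apply_eq_zero_iff F]
      intro g
      obtain ⟨u, hu⟩ := hdual.2 g
      have hu2 : (u : V) ∈ Submodule.map (f ^ (a / 2)) (W 0) := (hmapk (a / 2)).symm ▸ u.2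
      obtain ⟨x, hx, hxu⟩ := hu2
      rw [← hu]
      simp only [LinearMap.domRestrict_apply, Submodule.coe_sub, map_sub]
      rw [← hxu, hker2 ⟨x, hx⟩, sub_eq_zero]
      have h3 : (f ^ a) (w : V) = (f ^ (a / 2)) ((f ^ (a / 2)) (w : V)) := by
        rw [← Module.End.mul_apply, ← pow_add, haa]
      rw [h3, hinvk, hsymm]
    refine ⟨w, w.2, by simpa using hwne, ?_⟩
    have := congrArg Subtype.val (sub_eq_zero.mp hz)
    exact this
  have hfinj : ∀ k : ℕ, (f ^ k) w ≠ 0 := by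
    intro k h
    apply hwne
    have hi : Function.Injective (f ^ k) := by
      rw [Module.End.coe_pow]
      exact φ.injective.iterate k
    exact hi (by rw [h, map_zero])
  have hcast : Function.Injective (fun k : Fin a => ((k : ℕ) : ZMod a)) := by
    intro i j hij
    have h := (ZMod.natCast_eq_natCast_iff' _ _ _).mp hij
    rw [Nat.mod_eq_of_lt i.2, Nat.mod_eq_of_lt j.2] at h
    exact Fin.ext h
  have hli : LinearIndependent F (fun k : Fin a => (f ^ (k : ℕ)) w) :=
    iSupIndep.linearIndependent _ (hW.submodule_iSupIndep.comp hcast)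
      (fun k => hmem k w hw0) (fun k => hfinj k)
  have hmonic : (Polynomial.X ^ a - 1 : Polynomial F).Monic := by
    simpa using Polynomial.monic_X_pow_sub_C (1 : F) ha0.ne'
  rw [← Polynomial.modByMonic_eq_zero_iff_dvd hmonic]
  set r := f.charpoly %ₘ (Polynomial.X ^ a - 1) with hr
  have hdeg : r.natDegree < a := by
    have h := Polynomial.natDegree_modByMonic_lt f.charpoly hmonic (by
      intro h
      have := congrArg Polynomial.natDegree h
      rw [show (Polynomial.X ^ a - 1 : Polynomial F) = Polynomial.X ^ a - Polynomial.C 1 by simp,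
        Polynomial.natDegree_X_pow_sub_C] at this
      simp at this
      omega)
    rwa [show (Polynomial.X ^ a - 1 : Polynomial F) = Polynomial.X ^ a - Polynomial.C 1 by simp,
        Polynomial.natDegree_X_pow_sub_C, Polynomial.C_1] at h
  have hrw : (Polynomial.aeval f r) w = 0 := by
    have h := Polynomial.modByMonic_add_div f.charpoly (Polynomial.X ^ a - 1 : Polynomial F)
    have h2 := congrArg (fun p => (Polynomial.aeval f p) w) h
    simp only [LinearMap.aeval_self_charpoly, LinearMap.zero_apply, map_add, LinearMap.add_apply]
      at h2
    rw [mul_comm, map_mul, Module.End.mul_apply] at h2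
    simpa [hwfix] using h2
  rw [Polynomial.aeval_eq_sum_range' hdeg, LinearMap.sum_apply, Finset.sum_range] at hrw
  have hc := Fintype.linearIndependent_iff.mp hli (fun k => r.coeff k) (by simpa using hrw)
  ext k
  by_cases hk : k < a
  · simpa using hc ⟨k, hk⟩
  · simpa using Polynomial.coeff_eq_zero_of_natDegree_lt (by omega)
end
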